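/- arXiv:2012.04321 — 12 statements merged into one kernel-verified Lean document; each statement's English description precedes it below -/
import Mathlib

section
/- Let σ_S be a d_S×d_S density matrix that is diagonal, let the machine consist of two parts with energies given by diagonal Hamiltonians H_R on ℂ^{d_R} and H_H on ℂ^{d_H}, and let 0 ≤ β_H ≤ β_R. Write τ_R and τ_H^{(γ)} for the diagonal Gibbs density matrices of H_R at β_R and of H_H at inverse temperature γ, and let H = H_S⊗𝟙⊗𝟙 + 𝟙⊗H_R⊗𝟙 + 𝟙⊗𝟙⊗H_H on ℂ^{d_S}⊗ℂ^{d_R}⊗ℂ^{d_H}, where H_S is an arbitrary diagonal system Hamiltonian. Then for every unitary U_inc on ℂ^{d_S}⊗ℂ^{d_R}⊗ℂ^{d_H} with U_inc H = H U_inc there exists a unitary U on the same space such that D(Tr_M(U_inc (σ_S ⊗ τ_R ⊗ τ_H^{(β_H)}) U_inc†)) = D(Tr_M(U (σ_S ⊗ τ_R ⊗ τ_H^{(β_R)}) U†)), where Tr_M denotes the partial trace over both machine factors. -/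
open Matrix Kronecker ComplexOrder

/-- The Gibbs probability vector of energies `E` at inverse temperature `β`. -/
noncomputable def gibbs {d : ℕ} (E : Fin d → ℝ) (β : ℝ) : Fin d → ℝ :=
  fun i => Real.exp (-(β * E i)) / ∑ j, Real.exp (-(β * E j))

/-- The diagonal Gibbs density matrix of energies `E` at inverse temperature `β`. -/
noncomputable def gibbsMatrix {d : ℕ} (E : Fin d → ℝ) (β : ℝ) :
    Matrix (Fin d) (Fin d) ℂ :=
  Matrix.diagonal fun i => (gibbs E β i : ℂ)

/-- Partial trace over the second tensor factor (the machine). -/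
noncomputable def ptraceRight {n m : Type*} [Fintype m]
    (X : Matrix (n × m) (n × m) ℂ) : Matrix n n ℂ :=
  Matrix.of fun i i' => ∑ j, X (i, j) (i', j)


/-- Closure of a set of real vectors under transfers from a larger to a smaller entry. -/
def TClosed {ι : Type*} [DecidableEq ι] (S : Set (ι → ℝ)) : Prop :=
  ∀ x ∈ S, ∀ i j, i ≠ j → ∀ δ : ℝ, 0 ≤ δ → δ ≤ x i - x j →
    (x - Pi.single i δ + Pi.single j δ) ∈ S

lemma hlp {ι : Type*} [Fintype ι] [DecidableEq ι] (r : ι → ℕ) (hr : Function.Injective r)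
    (y : ι → ℝ) (hy : ∀ i j, r i ≤ r j → y j ≤ y i) (S : Set (ι → ℝ)) (hS : TClosed S) :
    ∀ (N : ℕ) (x : ι → ℝ), (Finset.univ.filter fun i => x i ≠ y i).card = N → x ∈ S →
      (∀ k : ℕ, ∑ i with r i < k, y i ≤ ∑ i with r i < k, x i) →
      ∑ i, x i = ∑ i, y i → y ∈ S := by
  intro N
  induction N using Nat.strong_induction_on with
  | _ N ih =>
  intro x hN hx hp ht
  by_cases hne : ∃ k, x k < y k
  swap
  · push Not at hne
    have : y = x := by
      funext i
      exact (Finset.sum_eq_sum_iff_of_le (fun i _ => hne i)).1 ht.symm i (Finset.mem_univ _)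
    rwa [this]
  obtain ⟨k, hk, hkmin⟩ : ∃ k, x k < y k ∧ ∀ i, r i < r k → y i ≤ x i := by
    obtain ⟨k0, hk0⟩ := hne
    obtain ⟨k, hk, hm⟩ := Finset.exists_min_image (Finset.univ.filter fun i => x i < y i) r
      ⟨k0, by simpa using hk0⟩
    refine ⟨k, by simpa using hk, fun i hi => ?_⟩
    by_contra h
    have := hm i (by simpa using h)
    omega
  obtain ⟨j, hj, hjk⟩ : ∃ j, y j < x j ∧ r j < r k := by
    by_contra h
    push Not at h
    have h1 := hp (r k + 1)
    have h2 : ∑ i with r i < r k + 1, x i < ∑ i with r i < r k + 1, y i := by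
      apply Finset.sum_lt_sum
      · intro i hi
        simp only [Finset.mem_filter, Finset.mem_univ, true_and] at hi
        by_contra hc
        have := h i (not_le.1 hc)
        have : r i = r k := by omega
        have := hr this
        subst this
        exact hc hk.le
      · exact ⟨k, by simp, hk⟩
    linarith
  have hjk' : j ≠ k := by rintro rfl; omega
  set δ := min (x j - y j) (y k - x k) with hδ
  have hδ0 : 0 ≤ δ := le_min (by linarith) (by linarith)
  have hδ1 : δ ≤ x j - y j := min_le_left _ _
  have hδ2 : δ ≤ y k - x k := min_le_right _ _
  have hyjk := hy j k hjk.le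
  have hx' := hS x hx j k hjk' δ hδ0 (by linarith)
  set x' := x - Pi.single j δ + Pi.single k δ with hx'def
  have hx'j : x' j = x j - δ := by simp [hx'def, hjk']
  have hx'k : x' k = x k + δ := by simp [hx'def, hjk'.symm]
  have hx'o : ∀ i, i ≠ j → i ≠ k → x' i = x i := by
    intro i h1 h2; simp [hx'def, h1, h2]
  refine ih _ ?_ x' rfl hx' ?_ ?_
  · rw [← hN]
    apply Finset.card_lt_card
    rw [Finset.ssubset_iff_of_subset]
    · rcases min_choice (x j - y j) (y k - x k) with h | h
      · refine ⟨j, by simpa using hj.ne', ?_⟩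
        simp only [Finset.mem_filter, Finset.mem_univ, true_and, not_not]
        rw [hx'j, hδ, h]; ring
      · refine ⟨k, by simpa using hk.ne, ?_⟩
        simp only [Finset.mem_filter, Finset.mem_univ, true_and, not_not]
        rw [hx'k, hδ, h]; ring
    · intro i hi
      simp only [Finset.mem_filter, Finset.mem_univ, true_and] at hi ⊢
      by_cases h1 : i = j
      · subst h1; exact hj.ne'
      by_cases h2 : i = k
      · subst h2; exact hk.ne
      rwa [hx'o i h1 h2] at hi
  · intro m
    have hs : ∑ i with r i < m, x' i = ∑ i with r i < m, x i
        - (if r j < m then δ else 0) + (if r k < m then δ else 0) := by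
      simp [hx'def, Finset.sum_add_distrib, Finset.sum_sub_distrib, Finset.sum_pi_single]
    rw [hs]
    by_cases hkm : r k < m
    · have : r j < m := by omega
      simp [hkm, this, hp m]
    · by_cases hjm : r j < m
      · simp only [hjm, hkm, if_true, if_false, add_zero]
        have : x j - y j ≤ ∑ i with r i < m, (x i - y i) := by
          apply Finset.single_le_sum (f := fun i => x i - y i)
          · intro i hi
            simp only [Finset.mem_filter, Finset.mem_univ, true_and] at hi
            have := hkmin i (by omega)
            linarith
          · simpa using hjm
        rw [Finset.sum_sub_distrib] at this
        linarith
      · simp [hkm, hjm, hp m]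
  · rw [← ht]
    simp [hx'def, Finset.sum_add_distrib, Finset.sum_sub_distrib]

lemma exists_rank {ι : Type*} [Fintype ι] (y : ι → ℝ) :
    ∃ r : ι ≃ Fin (Fintype.card ι), ∀ i j, r i ≤ r j → y j ≤ y i := by
  classical
  let e := Fintype.equivFin ι
  let f : Fin (Fintype.card ι) → ℝ := fun a => - y (e.symm a)
  refine ⟨e.trans (Tuple.sort f).symm, fun i j h => ?_⟩
  have := Tuple.monotone_sort f h
  simpa [f] using this

lemma TClosed.perm {ι : Type*} [Fintype ι] [DecidableEq ι] {S : Set (ι → ℝ)} (hS : TClosed S)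
    (π : Equiv.Perm ι) : ∀ x ∈ S, x ∘ π ∈ S := by
  induction π using Equiv.Perm.swap_induction_on with
  | one => intro x hx; exact hx
  | swap_mul f a b hab ih =>
    intro x hx
    have key : ∀ a b, a ≠ b → x b ≤ x a → x ∘ Equiv.swap a b ∈ S := by
      intro a b hab h
      have := hS x hx a b hab (x a - x b) (by linarith) le_rfl
      convert this using 1
      funext i
      by_cases h1 : i = a
      · subst h1; simp [hab]
      by_cases h2 : i = b
      · subst h2; simp [hab.symm]
      simp [Equiv.swap_apply_of_ne_of_ne h1 h2, h1, h2]
    have h2 : x ∘ Equiv.swap a b ∈ S := by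
      rcases le_total (x b) (x a) with h | h
      · exact key a b hab h
      · rw [Equiv.swap_comm]; exact key b a hab.symm h
    exact ih _ h2

lemma TClosed.doublyStochastic {ι : Type*} [Fintype ι] [DecidableEq ι] {S : Set (ι → ℝ)}
    (hS : TClosed S) (x : ι → ℝ) (hx : x ∈ S) (B : Matrix ι ι ℝ)
    (hB : B ∈ doublyStochastic ℝ ι) : B *ᵥ x ∈ S := by
  rw [mem_doublyStochastic_iff_sum] at hB
  obtain ⟨hB0, hB1, hB2⟩ := hB
  obtain ⟨ry, hry⟩ := exists_rank (B *ᵥ x)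
  obtain ⟨rx, hrx⟩ := exists_rank x
  let π : Equiv.Perm ι := ry.trans rx.symm
  have hz := hS.perm π x hx
  refine hlp (fun i => (ry i : ℕ)) (fun i j h => ry.injective (Fin.ext h)) _
    (fun i j h => hry i j h) S hS _ (x ∘ π) rfl hz ?_ ?_
  · intro k
    have e1 : ∑ i with (ry i : ℕ) < k, (x ∘ π) i = ∑ l, (if (rx l : ℕ) < k then 1 else 0) * x l := by
      rw [Finset.sum_filter, ← Equiv.sum_comp π (fun l => (if (rx l : ℕ) < k then 1 else 0) * x l)]
      simp [π]
    have e2 : ∑ i with (ry i : ℕ) < k, (B *ᵥ x) i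
        = ∑ l, (∑ i with (ry i : ℕ) < k, B i l) * x l := by
      simp only [Matrix.mulVec, dotProduct]
      rw [Finset.sum_comm]
      simp [Finset.sum_mul]
    rw [e1, e2]
    have hc0 : ∀ l, 0 ≤ ∑ i with (ry i : ℕ) < k, B i l :=
      fun l => Finset.sum_nonneg fun i _ => hB0 i l
    have hc1 : ∀ l, ∑ i with (ry i : ℕ) < k, B i l ≤ 1 := fun l => by
      rw [← hB2 l]
      exact Finset.sum_le_sum_of_subset_of_nonneg (Finset.subset_univ _) fun i _ _ => hB0 i l
    have hcs : ∑ l, ∑ i with (ry i : ℕ) < k, B i l = ∑ l, (if (rx l : ℕ) < k then (1:ℝ) else 0) := by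
      rw [Finset.sum_comm]
      simp only [hB1]
      rw [← Equiv.sum_comp π (fun l => if (rx l : ℕ) < k then (1:ℝ) else 0), Finset.sum_filter]
      simp [π]
    by_cases hk : k < Fintype.card ι
    · let m : ι := rx.symm ⟨k, hk⟩
      have : 0 ≤ ∑ l, ((if (rx l : ℕ) < k then (1:ℝ) else 0) - ∑ i with (ry i : ℕ) < k, B i l)
          * (x l - x m) := by
        apply Finset.sum_nonneg
        intro l _
        by_cases hl : (rx l : ℕ) < k
        · have : x m ≤ x l := hrx l m (by simp [m, Fin.le_def]; omega)
          rw [if_pos hl]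
          exact mul_nonneg (by linarith [hc1 l]) (by linarith)
        · have : x l ≤ x m := hrx m l (by simp [m, Fin.le_def]; omega)
          rw [if_neg hl]
          exact mul_nonneg_of_nonpos_of_nonpos (by linarith [hc0 l]) (by linarith)
      simp only [mul_sub, sub_mul, Finset.sum_sub_distrib, ← Finset.sum_mul] at this
      rw [hcs] at this
      linarith
    · have h1 : ∀ i : ι, (ry i : ℕ) < k := fun i => by have := (ry i).2; omega
      have h2 : ∀ i : ι, (rx i : ℕ) < k := fun i => by have := (rx i).2; omega
      simp [h1, h2, hB2]
  · have : ∑ i, (x ∘ π) i = ∑ i, x i := Equiv.sum_comp π x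
    rw [this]
    simp only [Matrix.mulVec, dotProduct]
    rw [Finset.sum_comm]
    simp [← Finset.sum_mul, hB2]

lemma tclosed_ds {ι : Type*} [Fintype ι] [DecidableEq ι] (x : ι → ℝ) :
    TClosed {v | ∃ D ∈ doublyStochastic ℝ ι, D *ᵥ x = v} := by
  rintro v ⟨D, hD, rfl⟩ i j hij δ h0 h1
  set v := D *ᵥ x with hv
  by_cases hd : v i - v j = 0
  · have : δ = 0 := by linarith
    subst this
    exact ⟨D, hD, by simp [hv]⟩
  have hpos : 0 < v i - v j := lt_of_le_of_ne (by linarith) (Ne.symm hd)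
  set t := δ / (v i - v j) with ht
  have ht0 : 0 ≤ t := by positivity
  have ht1 : t ≤ 1 := (div_le_one hpos).2 h1
  have hδ : t * (v i - v j) = δ := by rw [ht]; field_simp
  let P : Matrix ι ι ℝ := (Equiv.swap i j).permMatrix ℝ
  have hP : P ∈ doublyStochastic ℝ ι := permMatrix_mem_doublyStochastic
  have hT : (1 - t) • (1 : Matrix ι ι ℝ) + t • P ∈ doublyStochastic ℝ ι :=
    convex_doublyStochastic (one_mem _) hP (by linarith) ht0 (by ring)
  refine ⟨_, mul_mem hT hD, ?_⟩
  rw [← Matrix.mulVec_mulVec, ← hv, Matrix.add_mulVec, Matrix.smul_mulVec, Matrix.smul_mulVec,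
    Matrix.one_mulVec, Matrix.permMatrix_mulVec]
  funext l
  by_cases h1 : l = i
  · subst h1; simp [hij]; linarith
  by_cases h2 : l = j
  · subst h2; simp [hij.symm]; linarith
  simp [Equiv.swap_apply_of_ne_of_ne h1 h2, h1, h2]
  ring

lemma gibbs_ds {d : ℕ} (E : Fin d → ℝ) (βR βH : ℝ) (h0 : 0 ≤ βH) (h : βH ≤ βR) :
    ∃ D ∈ doublyStochastic ℝ (Fin d), D *ᵥ gibbs E βR = gibbs E βH := by
  rcases Nat.eq_zero_or_pos d with rfl | hd
  · exact ⟨1, one_mem _, by funext i; exact i.elim0⟩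
  have : Nonempty (Fin d) := ⟨⟨0, hd⟩⟩
  obtain ⟨r, hr⟩ := exists_rank (fun i => - E i)
  have hZ : ∀ β, 0 < ∑ j, Real.exp (-(β * E j)) := fun β =>
    Finset.sum_pos (fun _ _ => Real.exp_pos _) Finset.univ_nonempty
  have hsum : ∀ β, ∑ i, gibbs E β i = 1 := fun β => by
    simp only [gibbs, ← Finset.sum_div]
    exact div_self (hZ β).ne'
  have hcross : ∀ i j, r i ≤ r j → gibbs E βH j ≤ gibbs E βR j → gibbs E βH i ≤ gibbs E βR i := by
    intro i j hij hj
    have hE : E i ≤ E j := by have := hr i j hij; linarith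
    unfold gibbs at *
    rw [div_le_div_iff₀ (hZ _) (hZ _)] at *
    have e1 : Real.exp (-(βH * E i)) = Real.exp (-(βH * E j)) * Real.exp (βH * (E j - E i)) := by
      rw [← Real.exp_add]; ring_nf
    have e2 : Real.exp (-(βR * E i)) = Real.exp (-(βR * E j)) * Real.exp (βR * (E j - E i)) := by
      rw [← Real.exp_add]; ring_nf
    have e3 : Real.exp (βH * (E j - E i)) ≤ Real.exp (βR * (E j - E i)) :=
      Real.exp_le_exp.2 (mul_le_mul_of_nonneg_right h (by linarith))
    rw [e1, e2]
    calc _ = (Real.exp (-(βH * E j)) * ∑ j, Real.exp (-(βR * E j))) * Real.exp (βH * (E j - E i)) := by ring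
      _ ≤ (Real.exp (-(βR * E j)) * ∑ j, Real.exp (-(βH * E j))) * Real.exp (βR * (E j - E i)) :=
        mul_le_mul hj e3 (Real.exp_pos _).le (mul_nonneg (Real.exp_pos _).le (hZ _).le)
      _ = _ := by ring
  refine hlp (fun i => (r i : ℕ)) (fun i j h => r.injective (Fin.ext h)) (gibbs E βH) ?_ _
    (tclosed_ds (gibbs E βR)) _ (gibbs E βR) rfl ⟨1, one_mem _, by simp⟩ ?_ ?_
  · intro i j hij
    have hE : E i ≤ E j := by have := hr i j hij; linarith
    unfold gibbs
    apply div_le_div_of_nonneg_right _ (hZ _).le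
    exact Real.exp_le_exp.2 (neg_le_neg (mul_le_mul_of_nonneg_left hE h0))
  · intro k
    by_cases hk : ∃ j, k ≤ (r j : ℕ) ∧ gibbs E βH j ≤ gibbs E βR j
    · obtain ⟨j, hkj, hj⟩ := hk
      apply Finset.sum_le_sum
      intro i hi
      simp only [Finset.mem_filter, Finset.mem_univ, true_and] at hi
      exact hcross i j (by rw [Fin.le_def]; omega) hj
    · push Not at hk
      have a1 := Finset.sum_filter_add_sum_filter_not Finset.univ (fun i => (r i : ℕ) < k) (gibbs E βH)
      have a2 := Finset.sum_filter_add_sum_filter_not Finset.univ (fun i => (r i : ℕ) < k) (gibbs E βR)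
      rw [hsum] at a1 a2
      have : ∑ i with ¬ (r i : ℕ) < k, gibbs E βR i ≤ ∑ i with ¬ (r i : ℕ) < k, gibbs E βH i := by
        apply Finset.sum_le_sum
        intro i hi
        simp only [Finset.mem_filter, Finset.mem_univ, true_and, not_lt] at hi
        exact (hk i hi).le
      linarith
  · rw [hsum, hsum]

lemma exists_phase (a : ℂ) : ∃ w : ℂ, w * star w = 1 ∧ star w * a + w * star a = 0 := by
  by_cases ha : a = 0
  · exact ⟨1, by simp, by simp [ha]⟩
  · have hn : ((‖a‖ : ℝ) : ℂ) ≠ 0 := by exact_mod_cast (norm_pos_iff.2 ha).ne'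
    have hh : a * star a = (‖a‖ : ℂ) * ‖a‖ := by
      have := Complex.mul_conj' a
      rw [sq] at this; exact this
    refine ⟨Complex.I * a / ‖a‖, ?_, ?_⟩
    · simp only [star_div₀, star_mul', Complex.star_def, Complex.conj_I, Complex.conj_ofReal] at *
      field_simp
      linear_combination (-Complex.I ^ 2) * hh + (-(‖a‖:ℂ)^2) * Complex.I_sq
    · simp only [star_div₀, star_mul', Complex.star_def, Complex.conj_I, Complex.conj_ofReal] at *
      field_simp
      ring

lemma exists_rotation {ι : Type*} [Fintype ι] [DecidableEq ι] (A : Matrix ι ι ℂ)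
    (hA : A.IsHermitian) (i j : ι) (hij : i ≠ j) (t : ℝ) (ht0 : 0 ≤ t) (ht1 : t ≤ 1) :
    ∃ W ∈ Matrix.unitaryGroup ι ℂ,
      (W * A * Wᴴ) i i = (1 - t) * A i i + t * A j j ∧
      (W * A * Wᴴ) j j = t * A i i + (1 - t) * A j j ∧
      ∀ k, k ≠ i → k ≠ j → (W * A * Wᴴ) k k = A k k := by
  obtain ⟨w, hw1, hw2⟩ := exists_phase (A i j)
  have hAji : A j i = star (A i j) := (hA.apply j i).symm
  let c : ℂ := (Real.sqrt (1 - t) : ℝ)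
  let s : ℂ := (Real.sqrt t : ℝ)
  have hc : c * c = 1 - t := by
    simp only [c]; rw [← Complex.ofReal_mul, Real.mul_self_sqrt (by linarith)]; simp
  have hs : s * s = t := by
    simp only [s]; rw [← Complex.ofReal_mul, Real.mul_self_sqrt ht0]
  have hcc : star c = c := Complex.conj_ofReal _
  have hss : star s = s := Complex.conj_ofReal _
  let row : ι → ι → ℂ := fun k =>
    if k = i then Pi.single i c + Pi.single j (s * w)
    else if k = j then Pi.single i (-(s * star w)) + Pi.single j c
    else Pi.single k 1
  let W : Matrix ι ι ℂ := Matrix.of row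
  have hent : ∀ (M : Matrix ι ι ℂ) k l, (W * M * Wᴴ) k l = row k ⬝ᵥ (M *ᵥ star (row l)) := by
    intro M k l
    rw [Matrix.mul_assoc]
    rfl
  have ri : row i = Pi.single i c + Pi.single j (s * w) := by simp [row]
  have rj : row j = Pi.single i (-(s * star w)) + Pi.single j c := by simp [row, hij.symm]
  have ro : ∀ k, k ≠ i → k ≠ j → row k = Pi.single k 1 := by
    intro k h1 h2; simp [row, h1, h2]
  have hst : ∀ (k : ι) (z : ℂ), star (Pi.single k z : ι → ℂ) = Pi.single k (star z) := by
    intro k z; rw [Pi.single_star]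
  refine ⟨W, ?_, ?_, ?_, ?_⟩
  · rw [Matrix.mem_unitaryGroup_iff, Matrix.star_eq_conjTranspose]
    have hent' : ∀ k l, (W * Wᴴ) k l = row k ⬝ᵥ star (row l) := fun k l => rfl
    ext k l
    rw [hent']
    by_cases k1 : k = i
    · subst k1
      by_cases l1 : l = k
      · subst l1
        simp [ri, hst, hij, hij.symm, -Complex.star_def, hcc, hss]
        rw [Complex.star_def] at hw1
        linear_combination hc + s * s * hw1 + hs
      by_cases l2 : l = j
      · subst l2
        simp [ri, rj, hst, hij, hij.symm, -Complex.star_def, hcc, hss]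
        ring
      simp [ri, ro l l1 l2, hst, Ne.symm l1, Ne.symm l2, l1, l2]
    by_cases k2 : k = j
    · subst k2
      by_cases l1 : l = i
      · subst l1
        simp [ri, rj, hst, hij, hij.symm, -Complex.star_def, hcc, hss]
        ring
      by_cases l2 : l = k
      · subst l2
        simp [rj, hst, hij, hij.symm, -Complex.star_def, hcc, hss]
        rw [Complex.star_def] at hw1
        linear_combination hc + s * s * hw1 + hs
      simp [rj, ro l l1 l2, hst, Ne.symm l1, Ne.symm l2, l1, l2]
    rw [ro k k1 k2]
    by_cases l1 : l = i
    · subst l1; simp [ri, k1, k2]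
    by_cases l2 : l = j
    · subst l2; simp [rj, k1, k2]
    simp [ro l l1 l2, hst, Matrix.one_apply, Pi.single_apply, eq_comm]
  · rw [hent, ri]
    simp only [star_add, hst, Matrix.mulVec_add, add_dotProduct, dotProduct_add,
      single_dotProduct, Matrix.mulVec_single, Pi.smul_apply, Matrix.col_apply,
      MulOpposite.smul_eq_mul_unop, MulOpposite.unop_op, star_mul', hcc, hss, hAji]
    linear_combination (A i i) * hc + (A j j) * (s * s * hw1 + hs) + c * s * hw2
  · rw [hent, rj]
    simp only [star_add, hst, Matrix.mulVec_add, add_dotProduct, dotProduct_add,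
      single_dotProduct, Matrix.mulVec_single, Pi.smul_apply, Matrix.col_apply,
      MulOpposite.smul_eq_mul_unop, MulOpposite.unop_op, star_mul', star_neg, star_star,
      hcc, hss, hAji]
    linear_combination (A j j) * hc + (A i i) * (s * s * hw1 + hs) - c * s * hw2
  · intro k h1 h2
    rw [hent, ro k h1 h2, hst]
    simp

lemma tclosed_unitary {ι : Type*} [Fintype ι] [DecidableEq ι] (q : ι → ℝ) :
    TClosed {v : ι → ℝ | ∃ U ∈ Matrix.unitaryGroup ι ℂ,
      ∀ k, (U * Matrix.diagonal (fun l => (q l : ℂ)) * Uᴴ) k k = v k} := by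
  rintro v ⟨U, hU, hv⟩ i j hij δ h0 h1
  by_cases hd : v i - v j = 0
  · have : δ = 0 := by linarith
    subst this
    exact ⟨U, hU, by simpa using hv⟩
  have hpos : 0 < v i - v j := lt_of_le_of_ne (by linarith) (Ne.symm hd)
  set t := δ / (v i - v j) with ht
  have ht0 : 0 ≤ t := by positivity
  have ht1 : t ≤ 1 := (div_le_one hpos).2 h1
  have hδ : t * (v i - v j) = δ := by rw [ht]; field_simp
  have hδ' : (t : ℂ) * (v i - v j) = δ := by exact_mod_cast hδ
  have hA : (U * Matrix.diagonal (fun l => (q l : ℂ)) * Uᴴ).IsHermitian := by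
    apply Matrix.isHermitian_mul_mul_conjTranspose
    rw [Matrix.isHermitian_diagonal_iff]
    intro l
    exact Complex.conj_ofReal _
  obtain ⟨W, hW, hi, hj, hk⟩ := exists_rotation _ hA i j hij t ht0 ht1
  refine ⟨W * U, mul_mem hW hU, fun k => ?_⟩
  have e : W * U * Matrix.diagonal (fun l => (q l : ℂ)) * (W * U)ᴴ
      = W * (U * Matrix.diagonal (fun l => (q l : ℂ)) * Uᴴ) * Wᴴ := by
    rw [Matrix.conjTranspose_mul]; simp only [Matrix.mul_assoc]
  rw [e]
  by_cases h1 : k = i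
  · subst h1
    rw [hi, hv, hv]
    simp [hij]
    linear_combination -hδ'
  by_cases h2 : k = j
  · subst h2
    rw [hj, hv, hv]
    simp [hij.symm]
    linear_combination hδ'
  rw [hk k h1 h2, hv]
  simp [h1, h2]

lemma unitary_ds {ι : Type*} [Fintype ι] [DecidableEq ι] (U : Matrix ι ι ℂ)
    (hU : U ∈ Matrix.unitaryGroup ι ℂ) :
    (Matrix.of fun k l => Complex.normSq (U k l)) ∈ doublyStochastic ℝ ι := by
  rw [mem_doublyStochastic_iff_sum]
  refine ⟨fun i j => Complex.normSq_nonneg _, fun i => ?_, fun j => ?_⟩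
  · have := congrFun (congrFun (Matrix.mem_unitaryGroup_iff.1 hU) i) i
    simp only [Matrix.mul_apply, Matrix.star_apply, Matrix.one_apply_eq, Complex.star_def,
      Complex.mul_conj] at this
    exact_mod_cast this
  · have := congrFun (congrFun (Matrix.mem_unitaryGroup_iff'.1 hU) j) j
    simp only [Matrix.mul_apply, Matrix.star_apply, Matrix.one_apply_eq, Complex.star_def,
      mul_comm, Complex.mul_conj] at this
    exact_mod_cast this

lemma diag_conj {ι : Type*} [Fintype ι] [DecidableEq ι] (U : Matrix ι ι ℂ) (p : ι → ℝ) (k : ι) :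
    (U * Matrix.diagonal (fun l => (p l : ℂ)) * Uᴴ) k k
      = (((Matrix.of fun k l => Complex.normSq (U k l)) *ᵥ p) k : ℝ) := by
  rw [Matrix.mul_apply]
  simp only [Matrix.mul_diagonal, Matrix.conjTranspose_apply, Matrix.mulVec, dotProduct,
    Matrix.of_apply]
  push_cast
  refine Finset.sum_congr rfl fun l _ => ?_
  rw [← Complex.mul_conj, Complex.star_def]
  ring

theorem incoherent_reachable_coherently
    (dS dR dH : ℕ)
    (σ : Matrix (Fin dS) (Fin dS) ℂ)
    (hσdiag : σ.IsDiag) (hσpsd : σ.PosSemidef) (hσtr : σ.trace = 1)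
    (ES : Fin dS → ℝ) (ER : Fin dR → ℝ) (EH : Fin dH → ℝ)
    (βR βH : ℝ) (hβH : 0 ≤ βH) (hβ : βH ≤ βR)
    (H : Matrix (Fin dS × Fin dR × Fin dH) (Fin dS × Fin dR × Fin dH) ℂ)
    (hH : H = Matrix.diagonal fun p => ((ES p.1 + ER p.2.1 + EH p.2.2 : ℝ) : ℂ))
    (Uinc : Matrix (Fin dS × Fin dR × Fin dH) (Fin dS × Fin dR × Fin dH) ℂ)
    (hUinc : Uinc ∈ Matrix.unitaryGroup (Fin dS × Fin dR × Fin dH) ℂ)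
    (hcomm : Uinc * H = H * Uinc) :
    ∃ U ∈ Matrix.unitaryGroup (Fin dS × Fin dR × Fin dH) ℂ,
      Matrix.diag (ptraceRight
        (Uinc * (σ ⊗ₖ (gibbsMatrix ER βR ⊗ₖ gibbsMatrix EH βH)) * Uincᴴ)) =
      Matrix.diag (ptraceRight
        (U * (σ ⊗ₖ (gibbsMatrix ER βR ⊗ₖ gibbsMatrix EH βR)) * Uᴴ)) := by
  have hσ : σ = Matrix.diagonal fun i => (((σ i i).re : ℝ) : ℂ) := by
    ext i j
    by_cases h : i = j
    · subst h
      rw [Matrix.diagonal_apply_eq]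
      exact (hσpsd.isHermitian.coe_re_apply_self i).symm
    · rw [Matrix.diagonal_apply_ne _ h]; exact hσdiag h
  set s : Fin dS → ℝ := fun i => (σ i i).re with hs
  have hstate : ∀ β, σ ⊗ₖ (gibbsMatrix ER βR ⊗ₖ gibbsMatrix EH β) =
      Matrix.diagonal fun p : Fin dS × Fin dR × Fin dH =>
        ((s p.1 * (gibbs ER βR p.2.1 * gibbs EH β p.2.2) : ℝ) : ℂ) := by
    intro β
    rw [hσ]
    simp only [gibbsMatrix, Matrix.diagonal_kronecker_diagonal]
    push_cast
    rfl
  obtain ⟨D, hD, hDg⟩ := gibbs_ds EH βR βH hβH hβ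
  let K : Matrix (Fin dS × Fin dR × Fin dH) (Fin dS × Fin dR × Fin dH) ℝ :=
    (1 : Matrix (Fin dS) (Fin dS) ℝ) ⊗ₖ ((1 : Matrix (Fin dR) (Fin dR) ℝ) ⊗ₖ D)
  have hD' := mem_doublyStochastic_iff_sum.1 hD
  have hK : K ∈ doublyStochastic ℝ (Fin dS × Fin dR × Fin dH) := by
    rw [mem_doublyStochastic_iff_sum]
    refine ⟨?_, ?_, ?_⟩
    · rintro ⟨a, b, c⟩ ⟨a', b', c'⟩
      simp only [K, Matrix.kroneckerMap_apply, Matrix.one_apply]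
      have := hD'.1 c c'
      split_ifs <;> simp [this]
    · rintro ⟨a, b, c⟩
      simp [K, Fintype.sum_prod_type, Matrix.one_apply, hD'.2.1 c]
    · rintro ⟨a, b, c⟩
      simp [K, Fintype.sum_prod_type, Matrix.one_apply, hD'.2.2 c]
  let q : ℝ → (Fin dS × Fin dR × Fin dH) → ℝ := fun β p =>
    s p.1 * (gibbs ER βR p.2.1 * gibbs EH β p.2.2)
  have hKq : K *ᵥ q βR = q βH := by
    funext ⟨a, b, c⟩
    have := congrFun hDg c
    simp only [Matrix.mulVec, dotProduct] at this
    simp only [q, ← this, Finset.mul_sum]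
    simp [K, Matrix.mulVec, dotProduct, Fintype.sum_prod_type, Matrix.one_apply]
    exact Finset.sum_congr rfl fun _ _ => by ring
  obtain ⟨U, hU, hUv⟩ := (tclosed_unitary (q βR)).doublyStochastic (q βR)
    ⟨1, one_mem _, by simp⟩ _ (mul_mem (unitary_ds Uinc hUinc) hK)
  refine ⟨U, hU, ?_⟩
  rw [hstate, hstate]
  funext i
  simp only [Matrix.diag_apply, ptraceRight, Matrix.of_apply]
  refine Finset.sum_congr rfl fun m _ => ?_
  rw [diag_conj]
  refine Eq.trans ?_ (hUv (i, m)).symm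
  rw [← Matrix.mulVec_mulVec, hKq]
end

section
/- Let E_S ≥ 0 and ℰ_M ≥ 0, let H_S = diag(0, E_S) and H_M = diag(0, ℰ_M) be qubit Hamiltonians, and let H = H_S⊗𝟙 + 𝟙⊗H_M on ℂ²⊗ℂ². Let β_R > 0 and 0 ≤ β_H ≤ β_R, let τ_S be the diagonal Gibbs density matrix of H_S at β_R and τ_M^{H} that of H_M at β_H. Then for every unitary U on ℂ²⊗ℂ² satisfying UH = HU, the ground-state population of the reduced state does not increase: (Tr_M(U (τ_S ⊗ τ_M^{H}) U†))_{0,0} ≤ (τ_S)_{0,0}. In other words, a single-qubit machine cannot cool a qubit target in the incoherent scenario. -/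
open Matrix Kronecker

theorem single_qubit_machine_cannot_cool_incoherently
    (ES ℰM : ℝ) (hES : 0 ≤ ES) (hℰM : 0 ≤ ℰM)
    (βR βH : ℝ) (hβR : 0 < βR) (hβH : 0 ≤ βH) (hβ : βH ≤ βR)
    (H : Matrix (Fin 2 × Fin 2) (Fin 2 × Fin 2) ℂ)
    (hH : H = Matrix.diagonal fun p => (((p.1 : ℕ) * ES + (p.2 : ℕ) * ℰM : ℝ) : ℂ))
    (U : Matrix (Fin 2 × Fin 2) (Fin 2 × Fin 2) ℂ)
    (hU : U ∈ Matrix.unitaryGroup (Fin 2 × Fin 2) ℂ)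
    (hcomm : U * H = H * U) :
    (ptraceRight (U * ((gibbsMatrix (fun i : Fin 2 => (i : ℕ) * ES) βR) ⊗ₖ
        (gibbsMatrix (fun i : Fin 2 => (i : ℕ) * ℰM) βH)) * Uᴴ) 0 0).re ≤
      ((gibbsMatrix (fun i : Fin 2 => (i : ℕ) * ES) βR) 0 0).re := by
  classical
  have hrow : ∀ p, ∑ q, Complex.normSq (U p q) = 1 := by
    intro p
    have h1 : U * Uᴴ = 1 := (Matrix.mem_unitaryGroup_iff).1 hU
    have h2 := congrFun (congrFun h1 p) p
    rw [Matrix.mul_apply, Matrix.one_apply_eq] at h2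
    simp only [Matrix.conjTranspose_apply, RCLike.star_def, Complex.mul_conj] at h2
    exact_mod_cast h2
  have hsel : ∀ p q, U p q ≠ 0 → ((q.1 : ℕ) * ES + (q.2 : ℕ) * ℰM : ℝ) =
      ((p.1 : ℕ) * ES + (p.2 : ℕ) * ℰM : ℝ) := by
    intro p q hne
    have h2 := congrFun (congrFun hcomm p) q
    rw [hH, Matrix.mul_diagonal, Matrix.diagonal_mul, mul_comm] at h2
    exact_mod_cast mul_right_cancel₀ hne h2
  set s := gibbs (fun i : Fin 2 => (i : ℕ) * ES) βR with hs
  set m := gibbs (fun i : Fin 2 => (i : ℕ) * ℰM) βH with hm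
  have hpop : ∀ (j : Fin 2) (q : Fin 2 × Fin 2), U (0, j) q ≠ 0 →
      s q.1 * m q.2 ≤ s 0 * m j := by
    intro j q hne
    have h := hsel _ _ hne
    simp only [hs, hm, gibbs]
    rw [div_mul_div_comm, div_mul_div_comm, ← Real.exp_add, ← Real.exp_add]
    refine div_le_div_of_nonneg_right (Real.exp_le_exp.2 ?_) (by positivity)
    have h3 : 0 ≤ ((q.1 : ℕ) : ℝ) * ES := by positivity
    simp only [Fin.val_zero, Nat.cast_zero, zero_mul, zero_add] at h
    simp only [Fin.val_zero, Nat.cast_zero, zero_mul, mul_zero]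
    rw [← h]
    nlinarith [mul_le_mul_of_nonneg_right hβ h3]
  have hm1 : ∑ j, m j = 1 := by
    simp only [hm, gibbs]
    rw [← Finset.sum_div]
    exact div_self (by positivity)
  have hdiag : ∀ p, (U * ((gibbsMatrix (fun i : Fin 2 => (i : ℕ) * ES) βR) ⊗ₖ
        (gibbsMatrix (fun i : Fin 2 => (i : ℕ) * ℰM) βH)) * Uᴴ) p p =
      ((∑ q, Complex.normSq (U p q) * (s q.1 * m q.2) : ℝ) : ℂ) := by
    intro p
    unfold gibbsMatrix
    rw [Matrix.diagonal_kronecker_diagonal, Matrix.mul_apply]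
    push_cast
    refine Finset.sum_congr rfl fun q _ => ?_
    rw [Matrix.mul_diagonal, Matrix.conjTranspose_apply, RCLike.star_def,
      ← Complex.mul_conj]
    ring
  have hbound : ∀ j, ∑ q, Complex.normSq (U (0, j) q) * (s q.1 * m q.2) ≤ s 0 * m j := by
    intro j
    calc _ ≤ ∑ q, Complex.normSq (U (0, j) q) * (s 0 * m j) := by
          refine Finset.sum_le_sum fun q _ => ?_
          by_cases h0 : U (0, j) q = 0
          · simp [h0]
          · exact mul_le_mul_of_nonneg_left (hpop j q h0) (Complex.normSq_nonneg _)
      _ = s 0 * m j := by rw [← Finset.sum_mul, hrow, one_mul]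
  have hR : ((gibbsMatrix (fun i : Fin 2 => (i : ℕ) * ES) βR) 0 0).re = s 0 := by
    simp [gibbsMatrix, hs]
  rw [hR]
  simp only [ptraceRight, Matrix.of_apply, hdiag]
  rw [← Complex.ofReal_sum, Complex.ofReal_re]
  calc _ ≤ ∑ j, s 0 * m j := Finset.sum_le_sum fun j _ => hbound j
    _ = s 0 := by rw [← Finset.mul_sum, hm1, mul_one]
end

section
/- Let σ_S be an arbitrary d_S×d_S density matrix and let ρ_M be a diagonal d_M×d_M density matrix with diagonal entries (ρ_M)_0, …, (ρ_M)_{d_M−1}. Let ι : {0,…,c−1} → {0,…,d_M−1} be injective, let ρ_K be the c×c diagonal matrix with entries (ρ_K)_k = (ρ_M)_{ι(k)}, and set N = ∑_{k=0}^{c−1}(ρ_M)_{ι(k)}; assume N > 0. Then for every unitary U on ℂ^{d_S}⊗ℂ^{c} there exists a unitary Ũ on ℂ^{d_S}⊗ℂ^{d_M} such that Tr_M(Ũ (σ_S ⊗ ρ_M) Ũ†) = N · Tr_K(U (σ_S ⊗ (ρ_K/N)) U†) + (1−N) σ_S, where Tr_K denotes the partial trace over the second (c-dimensional) factor and Tr_M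 the partial trace over the second (d_M-dimensional) factor. -/
open Matrix Kronecker ComplexOrder

theorem unitary_on_machine_subspace_extends
    (dS dM c : ℕ)
    (σ : Matrix (Fin dS) (Fin dS) ℂ) (hσpsd : σ.PosSemidef) (hσtr : σ.trace = 1)
    (ρv : Fin dM → ℝ) (hρnn : ∀ i, 0 ≤ ρv i) (hρsum : ∑ i, ρv i = 1)
    (ι : Fin c → Fin dM) (hι : Function.Injective ι)
    (N : ℝ) (hN : N = ∑ k, ρv (ι k)) (hNpos : 0 < N)
    (U : Matrix (Fin dS × Fin c) (Fin dS × Fin c) ℂ)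
    (hU : U ∈ Matrix.unitaryGroup (Fin dS × Fin c) ℂ) :
    ∃ Ut ∈ Matrix.unitaryGroup (Fin dS × Fin dM) ℂ,
      ptraceRight (Ut * (σ ⊗ₖ (Matrix.diagonal fun i => (ρv i : ℂ))) * Utᴴ) =
        (N : ℂ) • ptraceRight
          (U * (σ ⊗ₖ (Matrix.diagonal fun k => ((ρv (ι k) / N : ℝ) : ℂ))) * Uᴴ)
        + ((1 - N : ℝ) : ℂ) • σ := by
  classical
  let e : Fin c ⊕ {x // x ∉ Set.range ι} ≃ Fin dM :=
    ((Equiv.ofInjective ι hι).sumCongr (Equiv.refl _)).trans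
      (Equiv.Set.sumCompl (Set.range ι))
  have el : ∀ k, e (Sum.inl k) = ι k := fun k => rfl
  let E : (Fin dS × Fin c) ⊕ (Fin dS × {x // x ∉ Set.range ι}) ≃ Fin dS × Fin dM :=
    (Equiv.prodSumDistrib _ _ _).symm.trans ((Equiv.refl _).prodCongr e)
  have Es : ∀ i s, E.symm (i, e s) = (Equiv.prodSumDistrib _ _ _) (i, s) := by
    intro i s
    rw [Equiv.symm_apply_eq]
    simp [E]
  let V := fromBlocks U 0 0
    (1 : Matrix (Fin dS × {x // x ∉ Set.range ι}) (Fin dS × {x // x ∉ Set.range ι}) ℂ)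
  let D2 : Matrix {x // x ∉ Set.range ι} {x // x ∉ Set.range ι} ℂ :=
    Matrix.diagonal fun r => (ρv (e (Sum.inr r)) : ℂ)
  let D1 : Matrix (Fin c) (Fin c) ℂ := Matrix.diagonal fun k => (ρv (ι k) : ℂ)
  have hV : V * Vᴴ = 1 := by
    have := (Matrix.mem_unitaryGroup_iff).1 hU
    rw [star_eq_conjTranspose] at this
    simp only [V, fromBlocks_conjTranspose, fromBlocks_multiply]
    simp [this]
  have hA : σ ⊗ₖ (Matrix.diagonal fun i => (ρv i : ℂ)) =
      (fromBlocks (σ ⊗ₖ D1) 0 0 (σ ⊗ₖ D2)).submatrix E.symm E.symm := by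
    ext ⟨i, j⟩ ⟨i', j'⟩
    obtain ⟨s, rfl⟩ := e.surjective j
    obtain ⟨s', rfl⟩ := e.surjective j'
    rw [submatrix_apply, Es, Es]
    rcases s with s | s <;> rcases s' with s' | s' <;>
      simp [kroneckerMap_apply, D1, D2, Matrix.diagonal_apply, ← el]
  have hN' : (N : ℂ) ≠ 0 := by exact_mod_cast hNpos.ne'
  have hD1 : D1 = (N : ℂ) • (Matrix.diagonal fun k => ((ρv (ι k) / N : ℝ) : ℂ)) := by
    ext a b
    simp only [D1, Matrix.diagonal_apply, Matrix.smul_apply, smul_eq_mul]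
    split_ifs
    · push_cast
      field_simp
    · simp
  have hs : ∑ r, ρv (e (Sum.inr r)) = 1 - N := by
    rw [← hρsum, ← e.sum_comp, Fintype.sum_sum_type, hN]
    simp [el]
  refine ⟨V.submatrix E.symm E.symm, ?_, ?_⟩
  · rw [Matrix.mem_unitaryGroup_iff, star_eq_conjTranspose, conjTranspose_submatrix,
      submatrix_mul_equiv, hV, submatrix_one_equiv]
  · rw [hA, conjTranspose_submatrix, submatrix_mul_equiv, submatrix_mul_equiv]
    have hP : V * (fromBlocks (σ ⊗ₖ D1) 0 0 (σ ⊗ₖ D2)) * Vᴴ =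
        fromBlocks (U * (σ ⊗ₖ D1) * Uᴴ) 0 0 (σ ⊗ₖ D2) := by
      simp [V, fromBlocks_conjTranspose, fromBlocks_multiply]
    rw [hP, ← hs]
    ext i i'
    simp only [ptraceRight, of_apply, Matrix.add_apply, Matrix.smul_apply, submatrix_apply]
    rw [← e.sum_comp, Fintype.sum_sum_type]
    simp only [Es]
    congr 1
    · rw [hD1, kronecker_smul]
      simp [Finset.mul_sum]
    · simp [D2, kroneckerMap_apply, Finset.mul_sum, mul_comm]
end

section
/- Let n and m be integers with 1 ≤ m < n, let w ∈ ℝ^n, and let r* denote the sum of the m largest entries of w. If v ∈ ℝ^n satisfies v ≺ w and ∑_{i=0}^{m−1} v_i = r*, then the first m entries of v are its largest entries: v_i ≥ v_j for all i < m ≤ j < n. -/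
/-- The sum of the `k` largest entries of `v`, as the supremum of sums over
subsets of cardinality `k`. -/
noncomputable def kMaxSum {n : ℕ} (v : Fin n → ℝ) (k : ℕ) : ℝ :=
  sSup ((fun s : Finset (Fin n) => ∑ i ∈ s, v i) '' {s : Finset (Fin n) | s.card = k})

/-- `IsMajorizedBy v w` means `v ≺ w` : for every `k ≤ n` the sum of the `k` largest
entries of `v` is at most that of `w`, with equal total sums. -/
def IsMajorizedBy {n : ℕ} (v w : Fin n → ℝ) : Prop :=
  (∀ k : ℕ, k ≤ n → kMaxSum v k ≤ kMaxSum w k) ∧ ∑ i, v i = ∑ i, w i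

theorem first_block_entries_are_largest
    (n m : ℕ) (hm : 1 ≤ m) (hmn : m < n)
    (w v : Fin n → ℝ)
    (hmaj : IsMajorizedBy v w)
    (hsum : ∑ i ∈ Finset.univ.filter (fun i : Fin n => (i : ℕ) < m), v i
      = kMaxSum w m) :
    ∀ i j : Fin n, (i : ℕ) < m → m ≤ (j : ℕ) → v j ≤ v i := by
  intro i j hi hj
  set S := Finset.univ.filter (fun i : Fin n => (i : ℕ) < m) with hS
  have hiS : i ∈ S := by simp [hS, hi]
  have hjS : j ∉ S.erase i := by simp [hS, hj]
  have hcard : S.card = m := by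
    rw [hS, Fin.card_filter_val_lt]
    exact min_eq_right hmn.le
  have hT : (insert j (S.erase i)).card = m := by
    rw [Finset.card_insert_of_notMem hjS, Finset.card_erase_of_mem hiS, hcard]
    omega
  have h1 : ∑ a ∈ insert j (S.erase i), v a ≤ kMaxSum v m :=
    le_csSup (Set.toFinite _).bddAbove ⟨_, hT, rfl⟩
  have h2 := hmaj.1 m hmn.le
  rw [Finset.sum_insert hjS] at h1
  have h3 := Finset.add_sum_erase S v hiS
  linarith
end

section
/- Let n and m be integers with 1 ≤ m < n, let w ∈ ℝ^n, let w↓ be the decreasing rearrangement of w, and let r* = ∑_{i=0}^{m−1} w↓_i. Write a = (w↓_0, …, w↓_{m−1}) ∈ ℝ^m and b = (w↓_m, …, w↓_{n−1}) ∈ ℝ^{n−m}. For v ∈ ℝ^n with ∑_{i=0}^{m−1} v_i = r*, write a_v = (v_0, …, v_{m−1}) and b_v = (v_m, …, v_{n−1}). Then v ≺ w if and only if a_v ≺ a and b_v ≺ b. -/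
/-- The decreasing rearrangement `w↓` of a vector `w`. -/
noncomputable def descSort {n : ℕ} (w : Fin n → ℝ) : Fin n → ℝ :=
  fun i => w (Tuple.sort w i.rev)

lemma kMaxSum_perm {n : ℕ} (w : Fin n → ℝ) (σ : Equiv.Perm (Fin n)) (k : ℕ) :
    kMaxSum (fun i => w (σ i)) k = kMaxSum w k := by
  unfold kMaxSum
  congr 1
  ext x
  constructor
  · rintro ⟨s, hs, rfl⟩
    refine ⟨s.map σ.toEmbedding, ?_, ?_⟩
    · simpa using hs
    · simp
  · rintro ⟨s, hs, rfl⟩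
    refine ⟨s.map σ.symm.toEmbedding, ?_, ?_⟩
    · simpa using hs
    · simp

lemma maj_descSort {n : ℕ} (v w : Fin n → ℝ) :
    IsMajorizedBy v w ↔ IsMajorizedBy v (descSort w) := by
  have h : descSort w = fun i => w ((Fin.revPerm.trans (Tuple.sort w)) i) := by
    ext i; simp [descSort]
  unfold IsMajorizedBy
  rw [h]
  simp only [kMaxSum_perm]
  rw [Equiv.sum_comp (Fin.revPerm.trans (Tuple.sort w)) w]

lemma descSort_anti {n : ℕ} (w : Fin n → ℝ) : Antitone (descSort w) := by
  intro i j hij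
  exact Tuple.monotone_sort w (Fin.rev_le_rev.2 hij)

lemma kMaxSum_le_iff {n : ℕ} (v : Fin n → ℝ) (k : ℕ) (hk : k ≤ n) (c : ℝ) :
    kMaxSum v k ≤ c ↔ ∀ s : Finset (Fin n), s.card = k → ∑ i ∈ s, v i ≤ c := by
  unfold kMaxSum
  rw [csSup_le_iff (Set.toFinite _).bddAbove]
  · simp
  · obtain ⟨s, -, hs⟩ := Finset.exists_subset_card_eq (s := (Finset.univ : Finset (Fin n)))
      (n := k) (by simpa using hk)
    exact ⟨_, s, hs, rfl⟩

lemma sum_le_prefix (n : ℕ) (D : ℕ → ℝ) (hD : ∀ i j, i ≤ j → j < n → D j ≤ D i)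
    (s : Finset ℕ) : s ⊆ Finset.range n → ∑ i ∈ s, D i ≤ ∑ i ∈ Finset.range s.card, D i := by
  induction s using Finset.induction_on_max with
  | empty => simp
  | insert a s ha ih =>
    intro hs
    have hna : a ∉ s := fun h => lt_irrefl _ (ha a h)
    have h1 := ih ((Finset.subset_insert a s).trans hs)
    have hc : s.card ≤ a := by
      have : s ⊆ Finset.range a := fun x hx => Finset.mem_range.2 (ha x hx)
      simpa using Finset.card_le_card this
    have han : a < n := Finset.mem_range.1 (hs (Finset.mem_insert_self a s))
    rw [Finset.sum_insert hna, Finset.card_insert_of_notMem hna, Finset.sum_range_succ]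
    linarith [hD _ _ hc han]

lemma maj_iff {n : ℕ} (v d : Fin n → ℝ) (hd : Antitone d) (V D : ℕ → ℝ)
    (hV : ∀ i : Fin n, V i = v i) (hD : ∀ i : Fin n, D i = d i) :
    IsMajorizedBy v d ↔
      (∀ s ⊆ Finset.range n, ∑ i ∈ s, V i ≤ ∑ i ∈ Finset.range s.card, D i) ∧
        ∑ i ∈ Finset.range n, V i = ∑ i ∈ Finset.range n, D i := by
  have hDa : ∀ i j, i ≤ j → j < n → D j ≤ D i := by
    intro i j hij hj
    have h1 := hD ⟨j, hj⟩
    have h2 := hD ⟨i, by omega⟩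
    simp only at h1 h2
    rw [h1, h2]
    exact hd (by simpa using hij)
  have key : ∀ (U : ℕ → ℝ) (u : Fin n → ℝ), (∀ i : Fin n, U i = u i) →
      ∀ k ≤ n, ∀ c, kMaxSum u k ≤ c ↔
        ∀ s ⊆ Finset.range n, s.card = k → ∑ i ∈ s, U i ≤ c := by
    intro U u hU k hk c
    rw [kMaxSum_le_iff u k hk]
    constructor
    · intro h s hs hc
      have hs' : ∀ i ∈ s, i < n := fun i hi => Finset.mem_range.1 (hs hi)
      have := h (s.attachFin hs') (by simpa using hc)
      refine le_trans (le_of_eq ?_) this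
      have e1 : ∑ i ∈ (s.attachFin hs').map Fin.valEmbedding, U i = ∑ i ∈ s, U i := by
        rw [Finset.map_valEmbedding_attachFin hs']
      rw [← e1, Finset.sum_map]
      simp [hU]
    · intro h s hc
      have := h (s.map Fin.valEmbedding) (by intro x; simp; rintro y _ rfl; exact y.2)
        (by simpa using hc)
      simpa [Finset.sum_map, hU] using this
  have hdk : ∀ k ≤ n, kMaxSum d k = ∑ i ∈ Finset.range k, D i := by
    intro k hk
    apply le_antisymm
    · rw [key D d hD k hk]
      rintro s hs rfl
      exact sum_le_prefix n D hDa s hs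
    · exact (key D d hD k hk _).1 le_rfl _ (by simpa using hk) (by simp)
  have e : ∀ (U : ℕ → ℝ) (u : Fin n → ℝ), (∀ i : Fin n, U i = u i) →
      ∑ i, u i = ∑ i ∈ Finset.range n, U i := by
    intro U u hU
    rw [Finset.sum_range]; simp [hU]
  unfold IsMajorizedBy
  rw [e V v hV, e D d hD]
  refine and_congr_left fun _ => ⟨fun h s hs => ?_, fun h k hk => ?_⟩
  · have hc : s.card ≤ n := by simpa using Finset.card_le_card hs
    have := h _ hc
    rw [hdk _ hc] at this
    exact (key V v hV _ hc _).1 this s hs rfl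
  · rw [hdk _ hk, key V v hV _ hk]
    rintro s hs rfl
    exact h s hs

theorem majorization_splits_into_blocks
    (n m : ℕ) (hm : 1 ≤ m) (hmn : m < n)
    (w v : Fin n → ℝ)
    (hsum : ∑ i : Fin m, v (Fin.castLE hmn.le i) =
      ∑ i : Fin m, descSort w (Fin.castLE hmn.le i)) :
    IsMajorizedBy v w ↔
      (IsMajorizedBy (fun i : Fin m => v (Fin.castLE hmn.le i))
          (fun i : Fin m => descSort w (Fin.castLE hmn.le i)) ∧
        IsMajorizedBy
          (fun i : Fin (n - m) => v ⟨m + (i : ℕ), by have := i.isLt; omega⟩)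
          (fun i : Fin (n - m) => descSort w ⟨m + (i : ℕ), by have := i.isLt; omega⟩)) := by
  rw [maj_descSort]
  set d := descSort w with hd
  have hda : Antitone d := descSort_anti w
  clear_value d
  obtain ⟨V, hV⟩ : ∃ V : ℕ → ℝ, ∀ i (h : i < n), V i = v ⟨i, h⟩ :=
    ⟨fun i => if h : i < n then v ⟨i, h⟩ else 0, fun i h => by simp [h]⟩
  obtain ⟨D, hD⟩ : ∃ D : ℕ → ℝ, ∀ i (h : i < n), D i = d ⟨i, h⟩ :=
    ⟨fun i => if h : i < n then d ⟨i, h⟩ else 0, fun i h => by simp [h]⟩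
  have hDa : ∀ i j, i ≤ j → j < n → D j ≤ D i := by
    intro i j hij hj
    rw [hD j hj, hD i (by omega)]
    exact hda (by simpa using hij)
  have hs : ∑ i ∈ Finset.range m, V i = ∑ i ∈ Finset.range m, D i := by
    rw [Finset.sum_range, Finset.sum_range]
    convert hsum using 2 with i _ i _
    · exact hV _ (by omega)
    · exact hD _ (by omega)
  rw [maj_iff v d hda V D (fun i => hV _ i.2) (fun i => hD _ i.2),
    maj_iff (fun i : Fin m => v (Fin.castLE hmn.le i))
      (fun i : Fin m => d (Fin.castLE hmn.le i)) (fun i j hij => hda (by simpa using hij)) V D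
      (fun i => hV _ (by omega)) (fun i => hD _ (by omega)),
    maj_iff (fun i : Fin (n - m) => v ⟨m + (i : ℕ), by have := i.isLt; omega⟩)
      (fun i : Fin (n - m) => d ⟨m + (i : ℕ), by have := i.isLt; omega⟩) (fun i j hij => hda (by simpa using hij))
      (fun i => V (m + i)) (fun i => D (m + i))
      (fun i => hV _ (by omega)) (fun i => hD _ (by omega))]
  have hn : n = m + (n - m) := by omega
  have split : ∀ (U : ℕ → ℝ), ∑ i ∈ Finset.range n, U i =
      ∑ i ∈ Finset.range m, U i + ∑ i ∈ Finset.range (n - m), U (m + i) := by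
    intro U
    conv_lhs => rw [hn]
    exact Finset.sum_range_add U m (n - m)
  rw [split V, split D]
  have hdisj : ∀ (p s : Finset ℕ), p ⊆ Finset.range m →
      Disjoint p (s.map (addLeftEmbedding m)) := by
    intro p s hp
    rw [Finset.disjoint_left]
    intro a ha hb
    have := Finset.mem_range.1 (hp ha)
    obtain ⟨x, _, rfl⟩ := Finset.mem_map.1 hb
    simp at this
  constructor
  · rintro ⟨h1, h2⟩
    refine ⟨⟨fun s hsm => h1 s (hsm.trans (Finset.range_subset_range.2 hmn.le)), hs⟩, ?_, by linarith⟩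
    intro s hsm
    have := h1 (Finset.range m ∪ s.map (addLeftEmbedding m)) (by
      intro x hx
      rcases Finset.mem_union.1 hx with hx | hx
      · have := Finset.mem_range.1 hx
        exact Finset.mem_range.2 (by omega)
      · obtain ⟨y, hy, rfl⟩ := Finset.mem_map.1 hx
        have := Finset.mem_range.1 (hsm hy)
        simp only [addLeftEmbedding_apply, Finset.mem_range]
        omega)
    rw [Finset.sum_union (hdisj _ _ subset_rfl), Finset.card_union_of_disjoint (hdisj _ _ subset_rfl),
      Finset.card_map, Finset.card_range, Finset.sum_range_add, Finset.sum_map] at this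
    simp only [addLeftEmbedding_apply] at this
    linarith
  · rintro ⟨⟨h1, -⟩, h2, h3⟩
    refine ⟨?_, by linarith⟩
    intro s hsn
    obtain ⟨p, q, hp, hq, rfl⟩ : ∃ p q : Finset ℕ, p ⊆ Finset.range m ∧ q ⊆ Finset.range (n - m) ∧
        s = p ∪ q.map (addLeftEmbedding m) := by
      refine ⟨s.filter (· < m), (Finset.range (n - m)).filter (fun i => m + i ∈ s), ?_,
        Finset.filter_subset _ _, ?_⟩
      · intro x; simp
      · ext x
        simp only [Finset.mem_union, Finset.mem_filter, Finset.mem_map, Finset.mem_range,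
          addLeftEmbedding_apply]
        constructor
        · intro hx
          by_cases hxm : x < m
          · exact Or.inl ⟨hx, hxm⟩
          · have := Finset.mem_range.1 (hsn hx)
            have e : m + (x - m) = x := by omega
            exact Or.inr ⟨x - m, ⟨by omega, by rwa [e]⟩, e⟩
        · rintro (⟨h, _⟩ | ⟨y, ⟨_, h⟩, rfl⟩) <;> exact h
    rw [Finset.sum_union (hdisj _ _ hp), Finset.card_union_of_disjoint (hdisj _ _ hp),
      Finset.card_map, Finset.sum_range_add, Finset.sum_map]
    refine add_le_add (h1 p hp) ((h2 q hq).trans (Finset.sum_le_sum fun i hi => ?_))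
    have hpc : p.card ≤ m := by simpa using Finset.card_le_card hp
    have hqc : q.card ≤ n - m := by simpa using Finset.card_le_card hq
    have := Finset.mem_range.1 hi
    exact hDa _ _ (by omega) (by omega)
end

section
/- Let β > 0 and 0 < E_S < ℰ_M. Set Z = (1+e^{−βE_S})(1+e^{−βℰ_M}), p = (1, e^{−βℰ_M}, e^{−βE_S}, e^{−β(E_S+ℰ_M)})/Z ∈ ℝ⁴ and h = (0, ℰ_M, E_S, E_S+ℰ_M) ∈ ℝ⁴. Set r_S = p_0+p_1 = 1/(1+e^{−βE_S}) and r_M = p_0+p_2 = 1/(1+e^{−βℰ_M}). Then for every c ∈ [r_S, r_M], the minimum of v·h over all v ∈ ℝ⁴ with v ≺ p and v_0+v_1 = c equals (c − p_0 + p_3)ℰ_M + (1−c)E_S = p·h + (c−r_S)(ℰ_M−E_S), and it is attained by v = (p_0, (1−μ)p_1+μp_2, μp_1+(1−μ)p_2, p_3) with μ = (c−r_S)/(r_M−r_S). -/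
lemma le_kMaxSum {n : ℕ} (v : Fin n → ℝ) (s : Finset (Fin n)) :
    ∑ i ∈ s, v i ≤ kMaxSum v s.card := by
  refine le_csSup ?_ ⟨s, rfl, rfl⟩
  exact ((Set.toFinite _).image _).bddAbove

lemma kMaxSum_le {n k : ℕ} (hk : k ≤ n) (v : Fin n → ℝ) (B : ℝ)
    (hB : ∀ s : Finset (Fin n), s.card = k → ∑ i ∈ s, v i ≤ B) : kMaxSum v k ≤ B := by
  refine csSup_le ?_ ?_
  · obtain ⟨s, -, hs⟩ := Finset.exists_subset_card_eq
      (s := (Finset.univ : Finset (Fin n))) (n := k) (by simpa using hk)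
    exact ⟨_, s, hs, rfl⟩
  · rintro _ ⟨s, hs, rfl⟩
    exact hB s hs

/-- A convex combination of `p` and a permutation of `p` is majorized by `p`. -/
lemma majorized_mix {n : ℕ} (p : Fin n → ℝ) (σ : Equiv.Perm (Fin n)) (μ : ℝ) (h0 : 0 ≤ μ)
    (h1 : μ ≤ 1) : IsMajorizedBy (fun i => (1 - μ) * p i + μ * p (σ i)) p := by
  constructor
  · intro k hk
    refine kMaxSum_le hk _ _ ?_
    intro s hs
    have e1 := le_kMaxSum p s
    have e2 := le_kMaxSum p (s.map σ.toEmbedding)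
    rw [Finset.card_map, hs, Finset.sum_map] at e2
    rw [hs] at e1
    simp only [Equiv.coe_toEmbedding] at e2
    rw [Finset.sum_add_distrib, ← Finset.mul_sum, ← Finset.mul_sum]
    nlinarith
  · rw [Finset.sum_add_distrib, ← Finset.mul_sum, ← Finset.mul_sum, Equiv.sum_comp]
    ring

theorem one_qubit_machine_optimal_cooling
    (β ES ℰM : ℝ) (hβ : 0 < β) (hES : 0 < ES) (hlt : ES < ℰM)
    (Z : ℝ) (hZ : Z = (1 + Real.exp (-(β * ES))) * (1 + Real.exp (-(β * ℰM))))
    (p : Fin 4 → ℝ)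
    (hp : p = ![1 / Z, Real.exp (-(β * ℰM)) / Z, Real.exp (-(β * ES)) / Z,
      Real.exp (-(β * (ES + ℰM))) / Z])
    (h : Fin 4 → ℝ) (hh : h = ![0, ℰM, ES, ES + ℰM])
    (rS rM : ℝ) (hrS : rS = p 0 + p 1) (hrM : rM = p 0 + p 2)
    (c : ℝ) (hc1 : rS ≤ c) (hc2 : c ≤ rM)
    (μ : ℝ) (hμ : μ = (c - rS) / (rM - rS))
    (v : Fin 4 → ℝ)
    (hv : v = ![p 0, (1 - μ) * p 1 + μ * p 2, μ * p 1 + (1 - μ) * p 2, p 3]) :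
    IsLeast {x : ℝ | ∃ u : Fin 4 → ℝ, IsMajorizedBy u p ∧ u 0 + u 1 = c ∧
        x = ∑ i, u i * h i}
      ((c - p 0 + p 3) * ℰM + (1 - c) * ES) ∧
    (c - p 0 + p 3) * ℰM + (1 - c) * ES =
      (∑ i, p i * h i) + (c - rS) * (ℰM - ES) ∧
    IsMajorizedBy v p ∧ v 0 + v 1 = c ∧
    (∑ i, v i * h i) = (c - p 0 + p 3) * ℰM + (1 - c) * ES := by
  have hZ0 : 0 < Z := by rw [hZ]; positivity
  have hM : 0 < ℰM := hES.trans hlt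
  set a := Real.exp (-(β * ES)) with ha
  set b := Real.exp (-(β * ℰM)) with hb
  have hab : Real.exp (-(β * (ES + ℰM))) = a * b := by
    rw [ha, hb, ← Real.exp_add]; ring_nf
  have ha0 : 0 < a := Real.exp_pos _
  have hb0 : 0 < b := Real.exp_pos _
  have hba : b < a := Real.exp_lt_exp.mpr (by nlinarith)
  have ha1 : a < 1 := Real.exp_lt_one_iff.mpr (by nlinarith [mul_pos hβ hES])
  rw [hab] at hp
  have q0 : p 0 = 1 / Z := by rw [hp]; rfl
  have q1 : p 1 = b / Z := by rw [hp]; rfl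
  have q2 : p 2 = a / Z := by rw [hp]; rfl
  have q3 : p 3 = a * b / Z := by rw [hp]; rfl
  have l20 : p 2 ≤ p 0 := by rw [q2, q0]; gcongr
  have l12 : p 1 < p 2 := by rw [q2, q1]; gcongr
  have l31 : p 3 ≤ p 1 := by rw [q3, q1]; gcongr; nlinarith
  have hsum : p 0 + p 1 + p 2 + p 3 = 1 := by
    rw [q0, q1, q2, q3]; field_simp; rw [hZ]; ring
  clear_value a b
  clear hp q0 q1 q2 q3
  have hd : 0 < rM - rS := by linarith
  have m0 : 0 ≤ μ := by rw [hμ]; exact div_nonneg (by linarith) hd.le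
  have m1 : μ ≤ 1 := by rw [hμ, div_le_one hd]; linarith
  have hμc : μ * (p 2 - p 1) = c - rS := by
    have : p 2 - p 1 = rM - rS := by rw [hrS, hrM]; ring
    rw [this, hμ]; field_simp
  have hmaj : IsMajorizedBy v p := by
    have := majorized_mix p (Equiv.swap 1 2) μ m0 m1
    convert this using 1
    rw [hv]
    funext i
    have s0 : Equiv.swap (1 : Fin 4) 2 0 = 0 := by decide
    have s1 : Equiv.swap (1 : Fin 4) 2 1 = 2 := by decide
    have s2 : Equiv.swap (1 : Fin 4) 2 2 = 1 := by decide
    have s3 : Equiv.swap (1 : Fin 4) 2 3 = 3 := by decide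
    fin_cases i
    · change p 0 = (1 - μ) * p 0 + μ * p (Equiv.swap (1 : Fin 4) 2 0)
      rw [s0]; ring
    · change (1 - μ) * p 1 + μ * p 2 = (1 - μ) * p 1 + μ * p (Equiv.swap (1 : Fin 4) 2 1)
      rw [s1]
    · change μ * p 1 + (1 - μ) * p 2 = (1 - μ) * p 2 + μ * p (Equiv.swap (1 : Fin 4) 2 2)
      rw [s2]; ring
    · change p 3 = (1 - μ) * p 3 + μ * p (Equiv.swap (1 : Fin 4) 2 3)
      rw [s3]; ring
  have v0 : v 0 = p 0 := by rw [hv]; rfl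
  have v1 : v 1 = (1 - μ) * p 1 + μ * p 2 := by rw [hv]; rfl
  have v2 : v 2 = μ * p 1 + (1 - μ) * p 2 := by rw [hv]; rfl
  have v3 : v 3 = p 3 := by rw [hv]; rfl
  have h0 : h 0 = 0 := by rw [hh]; rfl
  have h1 : h 1 = ℰM := by rw [hh]; rfl
  have h2 : h 2 = ES := by rw [hh]; rfl
  have h3 : h 3 = ES + ℰM := by rw [hh]; rfl
  have hvc : v 0 + v 1 = c := by rw [v0, v1]; linarith
  have hvh : (∑ i, v i * h i) = (c - p 0 + p 3) * ℰM + (1 - c) * ES := by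
    have e1 : v 1 = c - p 0 := by linarith
    have e2 : v 2 = 1 - c - p 3 := by rw [v2]; linarith
    rw [Fin.sum_univ_four, h0, h1, h2, h3, e1, e2, v3]; ring
  refine ⟨⟨⟨v, hmaj, hvc, hvh.symm⟩, ?_⟩, ?_, hmaj, hvc, hvh⟩
  · rintro x ⟨u, ⟨hu, hus⟩, huc, rfl⟩
    have le0 : ∀ i, p i ≤ p 0 := by
      intro i
      fin_cases i <;> simp <;> linarith
    have ge3 : ∀ i, p 3 ≤ p i := by
      intro i
      fin_cases i <;> simp <;> linarith
    have hu0 : u 0 ≤ p 0 := by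
      have A := le_kMaxSum u {0}
      rw [Finset.sum_singleton, Finset.card_singleton] at A
      refine (A.trans (hu 1 (by norm_num))).trans (kMaxSum_le (by norm_num) _ _ ?_)
      intro s hs
      obtain ⟨i, rfl⟩ := Finset.card_eq_one.mp hs
      rw [Finset.sum_singleton]
      exact le0 i
    have hu3 : u 0 + u 1 + u 2 ≤ 1 - p 3 := by
      have A := le_kMaxSum u {0, 1, 2}
      have hc3 : ({0, 1, 2} : Finset (Fin 4)).card = 3 := by decide
      have A' : ∑ i ∈ ({0, 1, 2} : Finset (Fin 4)), u i = u 0 + u 1 + u 2 := by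
        rw [Finset.sum_insert (by decide), Finset.sum_insert (by decide),
          Finset.sum_singleton]; ring
      rw [hc3, A'] at A
      refine (A.trans (hu 3 (by norm_num))).trans (kMaxSum_le (by norm_num) _ _ ?_)
      intro s hs
      have hsc : sᶜ.card = 1 := by rw [Finset.card_compl, hs]; rfl
      obtain ⟨i, hi⟩ := Finset.card_eq_one.mp hsc
      have := Finset.sum_add_sum_compl s p
      rw [hi, Finset.sum_singleton, Fin.sum_univ_four] at this
      linarith [ge3 i]
    rw [Fin.sum_univ_four, Fin.sum_univ_four] at hus
    rw [Fin.sum_univ_four, h0, h1, h2, h3]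
    have e2 : u 2 = 1 - c - u 3 := by linarith
    have k : 0 ≤ (u 1 + u 3 - (c - p 0 + p 3)) * ℰM := mul_nonneg (by linarith) hM.le
    rw [e2]
    linarith
  · rw [Fin.sum_univ_four, h0, h1, h2, h3, hrS]
    have e2 : p 2 = 1 - p 0 - p 1 - p 3 := by linarith
    rw [e2]; ring
end

section
/- Let β > 0, 0 < E_S < ℰ₂, and ℰ₁ = E_S + ℰ₂. For (s,m₁,m₂) ∈ {0,1}³ let the index i = 4s+2m₁+m₂ carry energy h_i = sE_S + m₁ℰ₁ + m₂ℰ₂, and let p ∈ ℝ⁸ have entries p_i = e^{−βh_i}/∑_{j=0}^{7} e^{−βh_j}. Set r_S = 1/(1+e^{−βE_S}), r₂ = 1/(1+e^{−βℰ₂}) and r₁ = 1/(1+e^{−βℰ₁}). Then the minimum of v·h over all v ∈ ℝ⁸ with v ≺ p and v_0+v_1+v_2+v_3 = c equals p·h + (c−r_S)(ℰ₂−E_S) when c ∈ [r_S, r₂], and equals p·h + (r₂−r_S)(ℰ₂−E_S) + (c−r₂)(ℰ₁−E_S) when c ∈ [r₂, r₁]. -/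
lemma kms_bdd {n : ℕ} (v : Fin n → ℝ) (k : ℕ) :
    BddAbove ((fun s : Finset (Fin n) => ∑ i ∈ s, v i) '' {s : Finset (Fin n) | s.card = k}) :=
  ((Set.toFinite _).image _).bddAbove

lemma kms_le {n : ℕ} (v : Fin n → ℝ) (k : ℕ) (s : Finset (Fin n)) (hs : s.card = k) :
    ∑ i ∈ s, v i ≤ kMaxSum v k :=
  le_csSup (kms_bdd v k) ⟨s, hs, rfl⟩

lemma kms_nonempty {n : ℕ} (v : Fin n → ℝ) (k : ℕ) (hk : k ≤ n) :
    ((fun s : Finset (Fin n) => ∑ i ∈ s, v i) '' {s : Finset (Fin n) | s.card = k}).Nonempty := by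
  obtain ⟨s, -, hs⟩ := Finset.exists_subset_card_eq (s := (Finset.univ : Finset (Fin n))) (n := k)
    (by simpa using hk)
  exact ⟨_, s, hs, rfl⟩

/-- Convex combinations of two rearrangements of `p` are majorized by `p`. -/
lemma maj_mix {n : ℕ} (p : Fin n → ℝ) (σ τ : Fin n → Fin n) (hσ : Function.Bijective σ)
    (hτ : Function.Bijective τ) (t : ℝ) (h0 : 0 ≤ t) (h1 : t ≤ 1) :
    IsMajorizedBy (fun i => (1 - t) * p (σ i) + t * p (τ i)) p := by
  refine ⟨fun k hk => csSup_le (kms_nonempty _ k hk) ?_, ?_⟩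
  · rintro _ ⟨s, hs, rfl⟩
    simp only [Finset.sum_add_distrib, ← Finset.mul_sum]
    have key : ∀ ρ : Fin n → Fin n, Function.Bijective ρ → ∑ i ∈ s, p (ρ i) ≤ kMaxSum p k := by
      intro ρ hρ
      have := kms_le p k (s.map ⟨ρ, hρ.1⟩) (by simpa using hs)
      simpa using this
    nlinarith [key σ hσ, key τ hτ]
  · simp only [Finset.sum_add_distrib, ← Finset.mul_sum]
    rw [hσ.sum_comp p, hτ.sum_comp p]
    ring

/-- For a decreasing rearrangement, the sum of the `k` largest entries is the initial sum. -/
lemma kms_sorted {n : ℕ} (w : Fin n → ℝ) (τ : Fin n → Fin n) (hτ : Function.Bijective τ)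
    (ha : Antitone (fun i => w (τ i))) (k : ℕ) (hk : k < n) :
    kMaxSum w k ≤ ∑ i : Fin n, if (i : ℕ) < k then w (τ i) else 0 := by
  refine csSup_le (kms_nonempty _ k hk.le) ?_
  rintro _ ⟨s, hs, rfl⟩
  set θ := w (τ ⟨k, hk⟩) with hθ
  have e1 : ∑ i ∈ s, w i = ∑ i, (if τ i ∈ s then (w (τ i) - θ) else 0) + k * θ := by
    rw [hτ.sum_comp (fun i => if i ∈ s then w i - θ else 0)]
    simp only [Finset.sum_ite_mem, Finset.univ_inter, Finset.sum_sub_distrib]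
    have : s.card = k := hs
    simp [this]
  have e2 : (∑ i : Fin n, if (i : ℕ) < k then w (τ i) else 0)
      = ∑ i : Fin n, (if (i : ℕ) < k then w (τ i) - θ else 0) + k * θ := by
    have : (k : ℝ) * θ = ∑ i : Fin n, if (i : ℕ) < k then θ else 0 := by
      rw [← Finset.sum_filter, Finset.sum_const, nsmul_eq_mul]
      congr 2
      have : (Finset.univ.filter (fun i : Fin n => (i : ℕ) < k)) = Finset.Iio ⟨k, hk⟩ := by
        ext i; simp [Fin.lt_def]
      rw [this]; simp
    rw [this, ← Finset.sum_add_distrib]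
    refine Finset.sum_congr rfl fun i _ => ?_
    split_ifs <;> ring
  simp only
  rw [e1, e2]
  gcongr with i
  by_cases hi : (i : ℕ) < k
  · have : θ ≤ w (τ i) := ha (show i ≤ ⟨k, hk⟩ from Fin.le_def.2 hi.le)
    simp only [hi, if_true]
    split_ifs <;> linarith
  · have : w (τ i) ≤ θ := ha (show ⟨k, hk⟩ ≤ i from Fin.le_def.2 (by simpa using hi))
    simp only [hi, if_false]
    split_ifs <;> linarith

lemma partial_le {n : ℕ} (v w : Fin n → ℝ) (hv : IsMajorizedBy v w) (σ τ : Fin n → Fin n)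
    (hσ : Function.Bijective σ) (hτ : Function.Bijective τ)
    (ha : Antitone (fun i => w (τ i))) (k : ℕ) (hk : k < n) :
    (∑ i : Fin n, if (i : ℕ) < k then v (σ i) else 0) ≤
      ∑ i : Fin n, if (i : ℕ) < k then w (τ i) else 0 := by
  refine le_trans ?_ ((hv.1 k hk.le).trans (kms_sorted w τ hτ ha k hk))
  have := kms_le v k ((Finset.Iio (⟨k, hk⟩ : Fin n)).map ⟨σ, hσ.1⟩) (by simp)
  rw [← Finset.sum_filter]
  have e : (Finset.univ.filter (fun i : Fin n => (i : ℕ) < k)) = Finset.Iio ⟨k, hk⟩ := by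
    ext i; simp [Fin.lt_def]
  rw [e]
  simpa using this

lemma rearr (v w g : Fin 8 → ℝ) (hv : IsMajorizedBy v w) (σ τ : Fin 8 → Fin 8)
    (hσ : Function.Bijective σ) (hτ : Function.Bijective τ)
    (ha : Antitone (fun i => w (τ i))) (hg : Monotone (fun i => g (σ i))) :
    ∑ i, w (τ i) * g (σ i) ≤ ∑ i, v i * g i := by
  have hs : ∑ i, v (σ i) = ∑ i, w (τ i) := by
    rw [hσ.sum_comp v, hτ.sum_comp w, hv.2]
  rw [← hσ.sum_comp (fun i => v i * g i)]
  have H := partial_le v w hv σ τ hσ hτ ha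
  have H1 := H 1 (by norm_num)
  have H2 := H 2 (by norm_num)
  have H3 := H 3 (by norm_num)
  have H4 := H 4 (by norm_num)
  have H5 := H 5 (by norm_num)
  have H6 := H 6 (by norm_num)
  have H7 := H 7 (by norm_num)
  clear H
  have G : ∀ i j : Fin 8, i ≤ j → 0 ≤ g (σ j) - g (σ i) := fun i j hij => sub_nonneg.2 (hg hij)
  have G1 := G 0 1 (by decide)
  have G2 := G 1 2 (by decide)
  have G3 := G 2 3 (by decide)
  have G4 := G 3 4 (by decide)
  have G5 := G 4 5 (by decide)
  have G6 := G 5 6 (by decide)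
  have G7 := G 6 7 (by decide)
  clear G
  simp [Fin.sum_univ_eight] at H1 H2 H3 H4 H5 H6 H7 hs ⊢
  have M1 := mul_nonneg G1 (sub_nonneg.2 H1)
  have M2 := mul_nonneg G2 (sub_nonneg.2 H2)
  have M3 := mul_nonneg G3 (sub_nonneg.2 H3)
  have M4 := mul_nonneg G4 (sub_nonneg.2 H4)
  have M5 := mul_nonneg G5 (sub_nonneg.2 H5)
  have M6 := mul_nonneg G6 (sub_nonneg.2 H6)
  have M7 := mul_nonneg G7 (sub_nonneg.2 H7)
  have hs7 : v (σ 7) = w (τ 0) + w (τ 1) + w (τ 2) + w (τ 3) + w (τ 4) + w (τ 5) + w (τ 6) + w (τ 7)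
    - (v (σ 0) + v (σ 1) + v (σ 2) + v (σ 3) + v (σ 4) + v (σ 5) + v (σ 6)) := by linarith
  rw [hs7]
  linarith

lemma mono8 (f : Fin 8 → ℝ) (h0 : f 0 ≤ f 1) (h1 : f 1 ≤ f 2) (h2 : f 2 ≤ f 3) (h3 : f 3 ≤ f 4)
    (h4 : f 4 ≤ f 5) (h5 : f 5 ≤ f 6) (h6 : f 6 ≤ f 7) : Monotone f := by
  rw [Fin.monotone_iff_le_succ]
  intro i
  fin_cases i <;> assumption

lemma anti8 (f : Fin 8 → ℝ) (h0 : f 1 ≤ f 0) (h1 : f 2 ≤ f 1) (h2 : f 3 ≤ f 2) (h3 : f 4 ≤ f 3)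
    (h4 : f 5 ≤ f 4) (h5 : f 6 ≤ f 5) (h6 : f 7 ≤ f 6) : Antitone f := by
  rw [Fin.antitone_iff_succ_le]
  intro i
  fin_cases i <;> assumption

lemma mix_param (a b c : ℝ) (hab : a < b) (h1 : a ≤ c) (h2 : c ≤ b) :
    ∃ t : ℝ, 0 ≤ t ∧ t ≤ 1 ∧ c = (1 - t) * a + t * b := by
  have : 0 < b - a := by linarith
  refine ⟨(c - a) / (b - a), div_nonneg (by linarith) this.le,
    (div_le_one this).2 (by linarith), ?_⟩
  field_simp
  ring

set_option maxHeartbeats 1000000 in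
theorem two_qubit_machine_optimal_cooling_large_gap
    (β ES ℰ2 : ℝ) (hβ : 0 < β) (hES : 0 < ES) (hgap : ES < ℰ2)
    (ℰ1 : ℝ) (hℰ1 : ℰ1 = ES + ℰ2)
    (h : Fin 8 → ℝ)
    (hh : ∀ i : Fin 8, h i = (((i : ℕ) / 4 : ℕ) : ℝ) * ES
      + ((((i : ℕ) / 2) % 2 : ℕ) : ℝ) * ℰ1 + (((i : ℕ) % 2 : ℕ) : ℝ) * ℰ2)
    (p : Fin 8 → ℝ)
    (hp : ∀ i, p i = Real.exp (-(β * h i)) / ∑ j, Real.exp (-(β * h j)))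
    (rS r2 r1 : ℝ) (hrS : rS = 1 / (1 + Real.exp (-(β * ES))))
    (hr2 : r2 = 1 / (1 + Real.exp (-(β * ℰ2))))
    (hr1 : r1 = 1 / (1 + Real.exp (-(β * ℰ1))))
    (c : ℝ) :
    (rS ≤ c → c ≤ r2 →
      IsLeast {x : ℝ | ∃ v : Fin 8 → ℝ, IsMajorizedBy v p ∧
          v 0 + v 1 + v 2 + v 3 = c ∧ x = ∑ i, v i * h i}
        ((∑ i, p i * h i) + (c - rS) * (ℰ2 - ES))) ∧
    (r2 ≤ c → c ≤ r1 →
      IsLeast {x : ℝ | ∃ v : Fin 8 → ℝ, IsMajorizedBy v p ∧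
          v 0 + v 1 + v 2 + v 3 = c ∧ x = ∑ i, v i * h i}
        ((∑ i, p i * h i) + (r2 - rS) * (ℰ2 - ES) + (c - r2) * (ℰ1 - ES))) := by
  set x := Real.exp (-(β * ES)) with hx
  set y := Real.exp (-(β * ℰ2)) with hy
  have x0 : 0 < x := Real.exp_pos _
  have y0 : 0 < y := Real.exp_pos _
  have x1 : x < 1 := by rw [hx, Real.exp_lt_one_iff]; linarith [mul_pos hβ hES]
  have yx : y < x := by rw [hx, hy, Real.exp_lt_exp]; linarith [mul_lt_mul_of_pos_left hgap hβ]
  have hxy : Real.exp (-(β * ℰ1)) = x * y := by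
    rw [hx, hy, ← Real.exp_add, hℰ1]; congr 1; ring
  rw [hxy] at hr1
  have h0 : h 0 = 0 := by rw [hh]; simp
  have h1 : h 1 = ℰ2 := by rw [hh]; simp
  have h2 : h 2 = ES + ℰ2 := by rw [hh]; simp [hℰ1]
  have h3 : h 3 = ES + 2 * ℰ2 := by rw [hh]; simp [hℰ1]; ring
  have h4 : h 4 = ES := by rw [hh]; simp
  have h5 : h 5 = ES + ℰ2 := by rw [hh]; simp
  have h6 : h 6 = 2 * ES + ℰ2 := by rw [hh]; simp [hℰ1]; ring
  have h7 : h 7 = 2 * ES + 2 * ℰ2 := by rw [hh]; simp [hℰ1]; ring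
  have e0 : Real.exp (-(β * h 0)) = 1 := by rw [h0]; simp
  have e1 : Real.exp (-(β * h 1)) = y := by rw [h1]
  have e2 : Real.exp (-(β * h 2)) = x * y := by
    rw [h2, hx, hy, ← Real.exp_add]; congr 1; ring
  have e3 : Real.exp (-(β * h 3)) = x * y * y := by
    rw [h3, hx, hy, ← Real.exp_add, ← Real.exp_add]; congr 1; ring
  have e4 : Real.exp (-(β * h 4)) = x := by rw [h4]
  have e5 : Real.exp (-(β * h 5)) = x * y := by
    rw [h5, hx, hy, ← Real.exp_add]; congr 1; ring
  have e6 : Real.exp (-(β * h 6)) = x * x * y := by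
    rw [h6, hx, hy, ← Real.exp_add, ← Real.exp_add]; congr 1; ring
  have e7 : Real.exp (-(β * h 7)) = x * x * y * y := by
    rw [h7, hx, hy, ← Real.exp_add, ← Real.exp_add, ← Real.exp_add]; congr 1; ring
  have hZ : ∑ j, Real.exp (-(β * h j)) = (1 + x) * (1 + y) * (1 + x * y) := by
    rw [Fin.sum_univ_eight, e0, e1, e2, e3, e4, e5, e6, e7]; ring
  simp only [hZ] at hp
  have xy0 : 0 < x * y := mul_pos x0 y0
  have hZ0 : 0 < (1 + x) * (1 + y) * (1 + x * y) := by positivity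
  have A1 : p 0 + p 1 + p 2 + p 3 = rS := by
    rw [hrS, hp, hp, hp, hp, e0, e1, e2, e3]; field_simp; ring
  have A2 : p 0 + p 4 + p 2 + p 6 = r2 := by
    rw [hr2, hp, hp, hp, hp, e0, e4, e2, e6]; field_simp; ring
  have A3 : p 0 + p 4 + p 1 + p 5 = r1 := by
    rw [hr1, hp, hp, hp, hp, e0, e4, e1, e5]; field_simp; ring
  have A4 : p 2 = p 5 := by rw [hp, hp, e2, e5]
  have L : ∀ i j, Real.exp (-(β * h i)) ≤ Real.exp (-(β * h j)) → p i ≤ p j := by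
    intro i j hij
    rw [hp, hp]
    exact div_le_div_of_nonneg_right hij hZ0.le
  have hS2 : rS < r2 := by
    rw [hrS, hr2]; apply one_div_lt_one_div_of_lt <;> linarith
  have h21 : r2 < r1 := by
    rw [hr2, hr1]; exact one_div_lt_one_div_of_lt (by linarith) (by linarith [mul_lt_of_lt_one_left y0 x1])
  have hanti : Antitone (fun i => p ((![0, 4, 1, 2, 5, 6, 3, 7] : Fin 8 → Fin 8) i)) := by
    apply anti8
    · exact L 4 0 (by rw [e4, e0]; exact x1.le)
    · exact L 1 4 (by rw [e4, e1]; exact yx.le)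
    · exact L 2 1 (by rw [e2, e1]; exact (mul_lt_of_lt_one_left y0 x1).le)
    · exact L 5 2 (by rw [e2, e5])
    · exact L 6 5 (by rw [e6, e5]; linarith [mul_lt_of_lt_one_left xy0 x1])
    · exact L 3 6 (by rw [e6, e3]; linarith [mul_lt_mul_of_pos_left yx xy0])
    · exact L 7 3 (by rw [e7, e3]; linarith [mul_lt_of_lt_one_left (mul_pos xy0 y0) x1])
  have bτ : Function.Bijective (![0, 4, 1, 2, 5, 6, 3, 7] : Fin 8 → Fin 8) := by decide
  have bq : Function.Bijective (![0, 4, 2, 6, 1, 5, 3, 7] : Fin 8 → Fin 8) := by decide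
  have br : Function.Bijective (![0, 4, 1, 5, 2, 6, 3, 7] : Fin 8 → Fin 8) := by decide
  have bσ : Function.Bijective (![0, 1, 2, 4, 3, 5, 6, 7] : Fin 8 → Fin 8) := by decide
  refine ⟨fun c1 c2 => ⟨?_, ?_⟩, fun c1 c2 => ⟨?_, ?_⟩⟩
  · obtain ⟨t, t0, t1, rfl⟩ := mix_param rS r2 c hS2 c1 c2
    refine ⟨_, maj_mix p id _ Function.bijective_id bq t t0 t1, ?_, ?_⟩
    · rw [← A1, ← A2]; simp; ring
    · rw [Fin.sum_univ_eight, Fin.sum_univ_eight, ← A1, ← A2]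
      simp [h0, h1, h2, h3, h4, h5, h6, h7]; ring
  · rintro _ ⟨v, hv, hc, rfl⟩
    have := rearr v p (![ES - ℰ2, ES, 2 * ES, 2 * ES + ℰ2, ES, ES + ℰ2, 2 * ES + ℰ2,
      2 * ES + 2 * ℰ2]) hv _ _ bτ bτ hanti (by apply mono8 <;> simp <;> linarith)
    simp [Fin.sum_univ_eight] at this
    rw [Fin.sum_univ_eight, Fin.sum_univ_eight, ← A1, ← hc, h0, h1, h2, h3, h4, h5, h6, h7]
    linarith
  · obtain ⟨t, t0, t1, rfl⟩ := mix_param r2 r1 c h21 c1 c2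
    refine ⟨_, maj_mix p _ _ bq br t t0 t1, ?_, ?_⟩
    · rw [← A3, ← A2]; simp; ring
    · rw [Fin.sum_univ_eight, Fin.sum_univ_eight, ← A1, ← A2, ← A3, hℰ1]
      simp [h0, h1, h2, h3, h4, h5, h6, h7, A4]; ring
  · rintro _ ⟨v, hv, hc, rfl⟩
    have := rearr v p (![- ℰ2, 0, ES, ES + ℰ2, ES, ES + ℰ2, 2 * ES + ℰ2,
      2 * ES + 2 * ℰ2]) hv _ _ bσ bτ hanti (by apply mono8 <;> simp <;> linarith)
    simp [Fin.sum_univ_eight] at this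
    rw [Fin.sum_univ_eight, Fin.sum_univ_eight, ← A1, ← A2, ← hc, h0, h1, h2, h3, h4, h5, h6, h7,
      hℰ1]
    rw [A4] at this ⊢
    linarith
end

section
/- For every 3×3 doubly stochastic matrix M there exists a 3×3 doubly stochastic matrix M̃ such that M(𝟙+Π) = (𝟙+Π)M̃, where Π is the 3×3 cyclic permutation matrix. -/
/-- A real square matrix is doubly stochastic if it has nonnegative entries and
all rows and columns sum to `1`. -/
def DoublyStochastic {n : ℕ} (M : Matrix (Fin n) (Fin n) ℝ) : Prop :=
  (∀ i j, 0 ≤ M i j) ∧ (∀ i, ∑ j, M i j = 1) ∧ (∀ j, ∑ i, M i j = 1)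

/-- The cyclic permutation matrix `Π` with `Π i j = 1` iff `i ≡ j + 1 (mod n)`. -/
def cyc (n : ℕ) : Matrix (Fin n) (Fin n) ℝ :=
  Matrix.of fun i j => if (i : ℕ) = ((j : ℕ) + 1) % n then 1 else 0

theorem doubly_stochastic_commutation_dim3
    (M : Matrix (Fin 3) (Fin 3) ℝ) (hM : DoublyStochastic M) :
    ∃ M' : Matrix (Fin 3) (Fin 3) ℝ, DoublyStochastic M' ∧
      M * (1 + cyc 3) = (1 + cyc 3) * M' := by
  obtain ⟨h0, hr, hc⟩ := hM
  have r0 := hr 0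
  have r1 := hr 1
  have r2 := hr 2
  have c0 := hc 0
  have c1 := hc 1
  have c2 := hc 2
  simp only [Fin.sum_univ_three] at r0 r1 r2 c0 c1 c2
  refine ⟨Matrix.of fun i j => M (i + 2) (j + 2), ⟨fun i j => h0 _ _, ?_, ?_⟩, ?_⟩
  · intro i
    fin_cases i <;> simp [Fin.sum_univ_three] <;> linarith
  · intro j
    fin_cases j <;> simp [Fin.sum_univ_three] <;> linarith
  · ext i j
    fin_cases i <;> fin_cases j <;>
      simp [Matrix.mul_apply, Fin.sum_univ_three, cyc, Matrix.one_apply] <;> linarith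
end

section
/- Let E_0 ≤ E_1 ≤ E_2 be real numbers and let 0 ≤ β' ≤ β. Let p = p(β) and q = p(β') be the corresponding Gibbs vectors in ℝ³, and define r_0 = (p_0², p_1², p_2²) and r_1 = (p_0p_1, p_1p_2, p_2p_0). Then there exist 3×3 doubly stochastic matrices M_0 and M_1 such that q = M_0 r_0 + (𝟙+Π) M_1 r_1, where Π is the 3×3 cyclic permutation matrix. (In other words, for two identical 3-dimensional systems initially thermal at inverse temperature β there is a symmetrically thermalizing transformation reaching any hotter thermal marginal.) -/
lemma seg_exists (a b x : ℝ) (h1 : b ≤ x) (h2 : x ≤ a) :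
    ∃ t : ℝ, 0 ≤ t ∧ t ≤ 1 ∧ x = (1 - t) * a + t * b := by
  rcases eq_or_lt_of_le (h1.trans h2) with h | h
  · exact ⟨0, le_rfl, zero_le_one, by linarith⟩
  · have h' : 0 < a - b := by linarith
    refine ⟨(a - x) / (a - b), div_nonneg (by linarith) h'.le, ?_, ?_⟩
    · rw [div_le_one h']; linarith
    · field_simp; ring

/-- Doubly stochastic reachability. -/
def Reach (p q : Fin 3 → ℝ) : Prop :=
  ∃ M : Matrix (Fin 3) (Fin 3) ℝ, DoublyStochastic M ∧ q = M.mulVec p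

lemma ds_iff (M : Matrix (Fin 3) (Fin 3) ℝ) :
    DoublyStochastic M ↔ M ∈ doublyStochastic ℝ (Fin 3) := by
  rw [mem_doublyStochastic_iff_sum]; rfl

lemma Reach.trans {p q r : Fin 3 → ℝ} (h : Reach p q) (h' : Reach q r) : Reach p r := by
  obtain ⟨M, hM, rfl⟩ := h
  obtain ⟨N, hN, rfl⟩ := h'
  refine ⟨N * M, ?_, by simp⟩
  rw [ds_iff] at *
  exact mul_mem hN hM

lemma reach01 (a b c x : ℝ) (h1 : b ≤ x) (h2 : x ≤ a) :
    Reach ![a, b, c] ![x, a + b - x, c] := by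
  obtain ⟨t, h0, h1, rfl⟩ := seg_exists a b x h1 h2
  refine ⟨!![1 - t, t, 0; t, 1 - t, 0; 0, 0, 1], ⟨?_, ?_, ?_⟩, ?_⟩
  · intro i j; fin_cases i <;> fin_cases j <;> simp <;> linarith
  · intro i; fin_cases i <;> simp [Fin.sum_univ_three]
  · intro i; fin_cases i <;> simp [Fin.sum_univ_three]
  · ext i; fin_cases i <;> simp [Matrix.mulVec, dotProduct, Fin.sum_univ_three]; ring

lemma reach02 (a b c x : ℝ) (h1 : c ≤ x) (h2 : x ≤ a) :
    Reach ![a, b, c] ![x, b, a + c - x] := by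
  obtain ⟨t, h0, h1, rfl⟩ := seg_exists a c x h1 h2
  refine ⟨!![1 - t, 0, t; 0, 1, 0; t, 0, 1 - t], ⟨?_, ?_, ?_⟩, ?_⟩
  · intro i j; fin_cases i <;> fin_cases j <;> simp <;> linarith
  · intro i; fin_cases i <;> simp [Fin.sum_univ_three]
  · intro i; fin_cases i <;> simp [Fin.sum_univ_three]
  · ext i; fin_cases i <;> simp [Matrix.mulVec, dotProduct, Fin.sum_univ_three]; ring

lemma reach12 (a b c x : ℝ) (h1 : c ≤ x) (h2 : x ≤ b) :
    Reach ![a, b, c] ![a, x, b + c - x] := by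
  obtain ⟨t, h0, h1, rfl⟩ := seg_exists b c x h1 h2
  refine ⟨!![1, 0, 0; 0, 1 - t, t; 0, t, 1 - t], ⟨?_, ?_, ?_⟩, ?_⟩
  · intro i j; fin_cases i <;> fin_cases j <;> simp <;> linarith
  · intro i; fin_cases i <;> simp [Fin.sum_univ_three]
  · intro i; fin_cases i <;> simp [Fin.sum_univ_three]
  · ext i; fin_cases i <;> simp [Matrix.mulVec, dotProduct, Fin.sum_univ_three]; ring

lemma reach_of_maj (a b c x y z : ℝ) (hs : a + b + c = x + y + z)
    (hxy : y ≤ x) (hyz : z ≤ y) (hx : x ≤ a) (hz : c ≤ z) :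
    Reach ![a, b, c] ![x, y, z] := by
  rcases le_total b y with h | h
  · have h1 := reach01 a b c (a + b - y) (by linarith) (by linarith)
    have h2 := reach02 (a + b - y) (a + b - (a + b - y)) c x (by linarith) (by linarith)
    convert h1.trans h2 using 1
    ext i; fin_cases i <;> simp; linarith
  · have h1 := reach12 a b c y (by linarith) (by linarith)
    have h2 := reach02 a y (b + c - y) x (by linarith) (by linarith)
    convert h1.trans h2 using 1
    ext i; fin_cases i <;> simp; linarith

lemma gibbs_sum (E : Fin 3 → ℝ) (β : ℝ) : gibbs E β 0 + gibbs E β 1 + gibbs E β 2 = 1 := by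
  have h : 0 < ∑ j, Real.exp (-(β * E j)) :=
    Finset.sum_pos (fun _ _ => Real.exp_pos _) Finset.univ_nonempty
  simp only [gibbs]
  rw [← add_div, ← add_div, div_eq_one_iff_eq h.ne', Fin.sum_univ_three]

lemma gibbs_anti (E : Fin 3 → ℝ) (hE : Monotone E) (β : ℝ) (hβ : 0 ≤ β) :
    Antitone (gibbs E β) := by
  intro i j hij
  have h : 0 < ∑ j, Real.exp (-(β * E j)) :=
    Finset.sum_pos (fun _ _ => Real.exp_pos _) Finset.univ_nonempty
  have := mul_le_mul_of_nonneg_left (hE hij) hβ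
  simp only [gibbs]
  gcongr

lemma gibbs_cmp (E : Fin 3 → ℝ) (b c : ℝ) (i : Fin 3)
    (h : ∀ j, 0 ≤ (c - b) * (E j - E i)) : gibbs E b i ≤ gibbs E c i := by
  have hp : ∀ β : ℝ, 0 < ∑ j, Real.exp (-(β * E j)) := fun β =>
    Finset.sum_pos (fun _ _ => Real.exp_pos _) Finset.univ_nonempty
  simp only [gibbs]
  rw [div_le_div_iff₀ (hp _) (hp _), Finset.mul_sum, Finset.mul_sum]
  refine Finset.sum_le_sum fun j _ => ?_
  rw [← Real.exp_add, ← Real.exp_add, Real.exp_le_exp]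
  nlinarith [h j]

theorem symmetric_thermalization_dim3
    (E : Fin 3 → ℝ) (hE : Monotone E)
    (β' β : ℝ) (hβ' : 0 ≤ β') (hββ : β' ≤ β)
    (p q : Fin 3 → ℝ) (hp : p = gibbs E β) (hq : q = gibbs E β')
    (r0 r1 : Fin 3 → ℝ)
    (hr0 : r0 = ![p 0 ^ 2, p 1 ^ 2, p 2 ^ 2])
    (hr1 : r1 = ![p 0 * p 1, p 1 * p 2, p 2 * p 0]) :
    ∃ M0 M1 : Matrix (Fin 3) (Fin 3) ℝ,
      DoublyStochastic M0 ∧ DoublyStochastic M1 ∧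
      q = M0.mulVec r0 + (1 + cyc 3).mulVec (M1.mulVec r1) := by
  have hR : Reach p q := by
    have e : ∀ v : Fin 3 → ℝ, v = ![v 0, v 1, v 2] := by
      intro v; ext i; fin_cases i <;> rfl
    rw [e p, e q]
    subst hp hq
    have hc : 0 ≤ β - β' := by linarith
    apply reach_of_maj
    · rw [gibbs_sum, gibbs_sum]
    · exact gibbs_anti E hE β' hβ' (by decide)
    · exact gibbs_anti E hE β' hβ' (by decide)
    · refine gibbs_cmp E _ _ _ fun j => mul_nonneg hc ?_
      have := hE (Fin.zero_le j)
      linarith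
    · refine gibbs_cmp E _ _ _ fun j => ?_
      have := hE (show j ≤ 2 from Fin.le_last j)
      nlinarith
  have hsum : p 0 + p 1 + p 2 = 1 := by rw [hp]; exact gibbs_sum E β
  clear hp hq
  obtain ⟨M, ⟨hn, hrow, hcol⟩, rfl⟩ := hR
  refine ⟨M, Matrix.of fun i j => M (i - 1) (j - 1), ⟨hn, hrow, hcol⟩,
    ⟨fun i j => hn _ _, fun i => ?_, fun j => ?_⟩, ?_⟩
  · exact ((Equiv.subRight (1 : Fin 3)).sum_comp (fun j => M (i - 1) j)).trans (hrow _)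
  · exact ((Equiv.subRight (1 : Fin 3)).sum_comp (fun i => M i (j - 1))).trans (hcol _)
  · subst hr0 hr1
    have s0 : (0 : Fin 3) - 1 = 2 := rfl
    have s1 : (1 : Fin 3) - 1 = 0 := rfl
    have s2 : (2 : Fin 3) - 1 = 1 := rfl
    have v0 : ∀ i, (Matrix.vecHead fun j => M i (j - 1)) = M i 2 := fun _ => rfl
    have v1 : ∀ i, Matrix.vecHead (Matrix.vecTail fun j => M i (j - 1)) = M i 0 := fun _ => rfl
    have v2 : ∀ i, Matrix.vecHead (Matrix.vecTail (Matrix.vecTail fun j => M i (j - 1))) = M i 1 :=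
      fun _ => rfl
    have c0 := hcol 0
    have c1 := hcol 1
    have c2 := hcol 2
    simp only [Fin.sum_univ_three] at c0 c1 c2
    have hp0 : p 0 = 1 - p 1 - p 2 := by linarith
    have key : ∀ i, M i 0 * p 0 + M i 1 * p 1 + M i 2 * p 2 =
        M i 0 * p 0 ^ 2 + M i 1 * p 1 ^ 2 + M i 2 * p 2 ^ 2
        + (1 - M i 2) * (p 0 * p 1) + (1 - M i 0) * (p 1 * p 2)
        + (1 - M i 1) * (p 2 * p 0) := by
      intro i
      have r := hrow i
      simp only [Fin.sum_univ_three] at r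
      have r0 : M i 0 = 1 - M i 1 - M i 2 := by linarith
      rw [r0, hp0]; ring
    have k0 := key 0
    have k1 := key 1
    have k2 := key 2
    ext i
    fin_cases i <;>
      simp [Matrix.mulVec, dotProduct, Fin.sum_univ_three, cyc, Matrix.add_apply,
        Matrix.one_apply, s0, s1, s2, v0, v1, v2]
    · rw [k0]
      linear_combination (-(p 0 * p 1)) * c2 - (p 1 * p 2) * c0 - (p 2 * p 0) * c1
    · rw [k1]
      linear_combination (-(p 0 * p 1)) * c2 - (p 1 * p 2) * c0 - (p 2 * p 0) * c1
    · rw [k2]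
      linear_combination (-(p 0 * p 1)) * c2 - (p 1 * p 2) * c0 - (p 2 * p 0) * c1
end

section
/- Let d ≥ 1, let E_0, …, E_{d−1} be real numbers, and let 0 ≤ β' ≤ β. For i ∈ {0, …, d−1} define r_i(γ) ∈ ℝ^d by (r_i(γ))_j = p_j(γ)·p_{j+i mod d}(γ), where p(γ) is the Gibbs vector at inverse temperature γ, and write ‖v‖ = ∑_j v_j for the sum of entries of a nonnegative vector v. Then for every i, r_i(β)/‖r_i(β)‖ majorizes r_i(β')/‖r_i(β')‖. -/
theorem exists_low_set {n : ℕ} (F : Fin n → ℝ) (k : ℕ) (hk : k ≤ n) :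
    ∃ t : Finset (Fin n), t.card = k ∧ ∀ a ∈ t, ∀ b ∉ t, F a ≤ F b := by
  classical
  have hne : (Finset.powersetCard k (Finset.univ : Finset (Fin n))).Nonempty := by
    apply Finset.powersetCard_nonempty.2
    simpa using hk
  obtain ⟨t, ht, hmin⟩ := Finset.exists_min_image _ (fun s => ∑ i ∈ s, F i) hne
  have htc : t.card = k := (Finset.mem_powersetCard.1 ht).2
  refine ⟨t, htc, fun a ha b hb => ?_⟩
  have hb' : b ∉ t.erase a := fun h => hb (Finset.mem_of_mem_erase h)
  have hpos : 0 < t.card := Finset.card_pos.2 ⟨a, ha⟩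
  have h := hmin (insert b (t.erase a)) (by
    rw [Finset.mem_powersetCard]
    refine ⟨Finset.subset_univ _, ?_⟩
    rw [Finset.card_insert_of_notMem hb', Finset.card_erase_of_mem ha]
    omega)
  simp only [Finset.sum_insert hb'] at h
  have h2 := Finset.add_sum_erase t F ha
  linarith

theorem sum_le_of_top {n : ℕ} (q : Fin n → ℝ) (s t : Finset (Fin n)) (hc : s.card = t.card)
    (h : ∀ a ∈ t, ∀ b ∉ t, q b ≤ q a) : ∑ i ∈ s, q i ≤ ∑ i ∈ t, q i := by
  classical
  have hcard : (s \ t).card = (t \ s).card := Finset.card_sdiff_comm hc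
  have e1 := Finset.sum_inter_add_sum_sdiff s t q
  have e2 := Finset.sum_inter_add_sum_sdiff t s q
  rw [Finset.inter_comm] at e2
  have key : ∑ i ∈ s \ t, q i ≤ ∑ i ∈ t \ s, q i := by
    rcases (t \ s).eq_empty_or_nonempty with he | hne
    · rw [he, Finset.card_empty, Finset.card_eq_zero] at hcard
      rw [he, hcard]
    · obtain ⟨a, ha, hmin⟩ := Finset.exists_min_image _ q hne
      have h1 : ∑ i ∈ s \ t, q i ≤ (s \ t).card • q a :=
        Finset.sum_le_card_nsmul _ _ _ fun b hb =>
          h a (Finset.mem_sdiff.1 ha).1 b (Finset.mem_sdiff.1 hb).2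
      have h2 : (t \ s).card • q a ≤ ∑ i ∈ t \ s, q i :=
        Finset.card_nsmul_le_sum _ _ _ hmin
      rw [hcard] at h1
      exact h1.trans h2
  linarith

theorem gibbs_sum_pos {d : ℕ} (hd : 1 ≤ d) (F : Fin d → ℝ) (γ : ℝ) :
    0 < ∑ l, Real.exp (-(γ * F l)) :=
  Finset.sum_pos (fun _ _ => Real.exp_pos _) ⟨⟨0, hd⟩, Finset.mem_univ _⟩

theorem ri_eq {d : ℕ} (hd : 1 ≤ d) (E : Fin d → ℝ) (γ : ℝ) (i : Fin d) :
    (fun j => gibbs E γ j * gibbs E γ (j + i) / ∑ l, gibbs E γ l * gibbs E γ (l + i))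
      = gibbs (fun j => E j + E (j + i)) γ := by
  have hZ := (gibbs_sum_pos hd E γ).ne'
  have hp : ∀ j, gibbs E γ j * gibbs E γ (j + i) =
      Real.exp (-(γ * (E j + E (j + i)))) / (∑ l, Real.exp (-(γ * E l))) ^ 2 := by
    intro j
    have : -(γ * (E j + E (j + i))) = -(γ * E j) + -(γ * E (j + i)) := by ring
    rw [this, Real.exp_add]
    unfold gibbs
    field_simp
  funext j
  simp only [hp]
  rw [← Finset.sum_div, div_div_div_cancel_right₀ (pow_ne_zero 2 hZ)]
  rfl

theorem gibbs_sum_mono {d : ℕ} (hd : 1 ≤ d) (F : Fin d → ℝ) (β' β : ℝ) (hββ : β' ≤ β)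
    (t : Finset (Fin d)) (ht : ∀ a ∈ t, ∀ b ∉ t, F a ≤ F b) :
    ∑ j ∈ t, gibbs F β' j ≤ ∑ j ∈ t, gibbs F β j := by
  classical
  unfold gibbs
  rw [← Finset.sum_div, ← Finset.sum_div,
    div_le_div_iff₀ (gibbs_sum_pos hd F β') (gibbs_sum_pos hd F β),
    ← Finset.sum_add_sum_compl t (fun j => Real.exp (-(β * F j))),
    ← Finset.sum_add_sum_compl t (fun j => Real.exp (-(β' * F j)))]
  have key : (∑ a ∈ t, Real.exp (-(β' * F a))) * ∑ b ∈ tᶜ, Real.exp (-(β * F b)) ≤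
      (∑ a ∈ t, Real.exp (-(β * F a))) * ∑ b ∈ tᶜ, Real.exp (-(β' * F b)) := by
    rw [Finset.sum_mul_sum, Finset.sum_mul_sum]
    refine Finset.sum_le_sum fun a ha => Finset.sum_le_sum fun b hb => ?_
    rw [← Real.exp_add, ← Real.exp_add, Real.exp_le_exp]
    have := ht a ha b (Finset.mem_compl.1 hb)
    nlinarith
  nlinarith

theorem normalized_ri_majorization
    (d : ℕ) (hd : 1 ≤ d) (E : Fin d → ℝ)
    (β' β : ℝ) (hβ' : 0 ≤ β') (hββ : β' ≤ β) (i : Fin d) :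
    IsMajorizedBy
      (fun j => gibbs E β' j * gibbs E β' (j + i) /
        ∑ l, gibbs E β' l * gibbs E β' (l + i))
      (fun j => gibbs E β j * gibbs E β (j + i) /
        ∑ l, gibbs E β l * gibbs E β (l + i)) := by
  rw [ri_eq hd, ri_eq hd]
  generalize (fun j => E j + E (j + i)) = F
  refine ⟨fun k hk => ?_, ?_⟩
  · obtain ⟨t, htc, ht⟩ := exists_low_set F k hk
    unfold kMaxSum
    refine csSup_le ⟨_, t, htc, rfl⟩ ?_
    rintro _ ⟨s, hs, rfl⟩
    have hs' : s.card = k := hs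
    have h1 : ∑ j ∈ s, gibbs F β' j ≤ ∑ j ∈ t, gibbs F β' j := by
      refine sum_le_of_top _ s t (hs'.trans htc.symm) fun a ha b hb => ?_
      have hab := ht a ha b hb
      unfold gibbs
      refine div_le_div_of_nonneg_right (Real.exp_le_exp.2 ?_) (gibbs_sum_pos hd F β').le
      nlinarith
    refine (h1.trans (gibbs_sum_mono hd F β' β hββ t ht)).trans ?_
    exact le_csSup (Set.toFinite _).bddAbove ⟨t, htc, rfl⟩
  · unfold gibbs
    rw [← Finset.sum_div, ← Finset.sum_div, div_self (gibbs_sum_pos hd F β').ne',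
      div_self (gibbs_sum_pos hd F β).ne']
end

section
/- Let E_0 ≤ E_1 ≤ E_2 be real numbers and let 0 ≤ β' ≤ β. Write p = p(β) and q = p(β') for the Gibbs vectors in ℝ³. Then the normalized vector (p_0², p_1², p_2²)/(p_0²+p_1²+p_2²) majorizes the normalized vector (q_0q_1+q_2q_0, q_1q_2+q_0q_1, q_2q_0+q_1q_2)/(2(q_0q_1+q_1q_2+q_2q_0)). -/
lemma kMaxSum_le_of {n : ℕ} (v w : Fin n → ℝ) (k : ℕ) (hk : k ≤ n)
    (h : ∀ s : Finset (Fin n), ∃ t : Finset (Fin n), t.card = s.card ∧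
      ∑ i ∈ s, v i ≤ ∑ i ∈ t, w i) : kMaxSum v k ≤ kMaxSum w k := by
  unfold kMaxSum
  apply csSup_le
  · obtain ⟨s, _, hs⟩ := Finset.exists_subset_card_eq (s := (Finset.univ : Finset (Fin n)))
      (n := k) (by simpa using hk)
    exact ⟨_, s, hs, rfl⟩
  · rintro _ ⟨s, hs, rfl⟩
    obtain ⟨t, ht, hle⟩ := h s
    refine le_trans hle (le_csSup (Set.toFinite _).bddAbove ⟨t, ?_, rfl⟩)
    exact ht.trans hs

lemma majorized_three (v w : Fin 3 → ℝ) (h01 : v 1 ≤ v 0) (h12 : v 2 ≤ v 1)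
    (h0 : v 0 ≤ w 0) (h2 : w 2 ≤ v 2) (hs : ∑ i, v i = ∑ i, w i) : IsMajorizedBy v w := by
  refine ⟨fun k hk => kMaxSum_le_of v w k hk ?_, hs⟩
  have hs' := hs
  simp only [Fin.sum_univ_three] at hs'
  intro s
  have hc : s = ∅ ∨ s = {0} ∨ s = {1} ∨ s = {2} ∨ s = {0, 1} ∨ s = {0, 2} ∨ s = {1, 2}
      ∨ s = Finset.univ := by
    revert s; decide
  rcases hc with rfl | rfl | rfl | rfl | rfl | rfl | rfl | rfl
  · exact ⟨∅, rfl, by simp⟩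
  · exact ⟨{0}, rfl, by simp; linarith⟩
  · exact ⟨{0}, rfl, by simp; linarith⟩
  · exact ⟨{0}, rfl, by simp; linarith⟩
  · exact ⟨{0, 1}, rfl, by simp; linarith⟩
  · exact ⟨{0, 1}, rfl, by simp; linarith⟩
  · exact ⟨{0, 1}, rfl, by simp; linarith⟩
  · exact ⟨Finset.univ, rfl, hs.le⟩

lemma gibbs_pos {d : ℕ} (E : Fin d → ℝ) (β : ℝ) (i : Fin d) : 0 < gibbs E β i := by
  unfold gibbs
  exact div_pos (Real.exp_pos _)
    (Finset.sum_pos (fun _ _ => Real.exp_pos _) ⟨i, Finset.mem_univ i⟩)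

lemma gibbs_anti_s16 {d : ℕ} (E : Fin d → ℝ) (β : ℝ) (hβ : 0 ≤ β) (i j : Fin d)
    (h : E i ≤ E j) : gibbs E β j ≤ gibbs E β i := by
  unfold gibbs
  apply div_le_div_of_nonneg_right _ (Finset.sum_nonneg fun _ _ => (Real.exp_pos _).le)
  apply Real.exp_le_exp.2
  nlinarith

lemma gibbs_ratio {d : ℕ} (E : Fin d → ℝ) (β' β : ℝ) (hβ : β' ≤ β) (i j : Fin d)
    (h : E i ≤ E j) :
    gibbs E β j * gibbs E β' i ≤ gibbs E β i * gibbs E β' j := by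
  unfold gibbs
  rw [div_mul_div_comm, div_mul_div_comm, ← Real.exp_add, ← Real.exp_add]
  apply div_le_div_of_nonneg_right _ (mul_nonneg
    (Finset.sum_nonneg fun _ _ => (Real.exp_pos _).le)
    (Finset.sum_nonneg fun _ _ => (Real.exp_pos _).le))
  apply Real.exp_le_exp.2
  nlinarith [mul_nonneg (sub_nonneg.2 hβ) (sub_nonneg.2 h)]

lemma ineq_top (a b c : ℝ) (hc : 0 < c) (hab : b ≤ a) (hbc : c ≤ b) :
    (a * b + c * a) / (2 * (a * b + b * c + c * a)) ≤ a ^ 2 / (a ^ 2 + b ^ 2 + c ^ 2) := by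
  have hb : 0 < b := by linarith
  have ha : 0 < a := by linarith
  rw [div_le_div_iff₀ (by positivity) (by positivity)]
  have key : 0 ≤ (b + c) * (a ^ 2 - b ^ 2 - c ^ 2) + 2 * a * b * c := by
    have h1 : 0 ≤ (a - b) * ((b + c) * (a + b) + 2 * b * c) :=
      mul_nonneg (by linarith) (by positivity)
    have h2 : 0 ≤ c * ((b - c) * (2 * b + c)) :=
      mul_nonneg hc.le (mul_nonneg (by linarith) (by positivity))
    nlinarith
  nlinarith [mul_nonneg ha.le key]

lemma ineq_bot (a b c : ℝ) (hc : 0 < c) (hab : b ≤ a) (hbc : c ≤ b) :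
    c ^ 2 / (a ^ 2 + b ^ 2 + c ^ 2) ≤ (c * a + b * c) / (2 * (a * b + b * c + c * a)) := by
  have hb : 0 < b := by linarith
  have ha : 0 < a := by linarith
  rw [div_le_div_iff₀ (by positivity) (by positivity)]
  have key : 0 ≤ (a + b) * (a ^ 2 + b ^ 2 - c ^ 2) - 2 * a * b * c := by
    have h1 : 0 ≤ (a + b) * ((b - c) * (b + c)) :=
      mul_nonneg (by positivity) (mul_nonneg (by linarith) (by positivity))
    have h2 : 0 ≤ a * (a * (a - b)) :=
      mul_nonneg ha.le (mul_nonneg ha.le (by linarith))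
    have h3 : 0 ≤ 2 * a * b * (b - c) := mul_nonneg (by positivity) (by linarith)
    have h4 : 0 ≤ 2 * a * b * (a - b) := mul_nonneg (by positivity) (by linarith)
    nlinarith
  nlinarith [mul_nonneg hc.le key]

lemma sq_ratio (x y z w : ℝ) (hx : 0 < x) (hy : 0 < y) (h : x * y ≤ z * w) :
    x ^ 2 * y ^ 2 ≤ z ^ 2 * w ^ 2 := by
  rw [← mul_pow, ← mul_pow]
  exact pow_le_pow_left₀ (mul_pos hx hy).le h 2


theorem r0_majorizes_mixed_b1_dim3
    (E : Fin 3 → ℝ) (hE : Monotone E)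
    (β' β : ℝ) (hβ' : 0 ≤ β') (hββ : β' ≤ β)
    (p q : Fin 3 → ℝ) (hp : p = gibbs E β) (hq : q = gibbs E β') :
    IsMajorizedBy
      (fun k => ![q 0 * q 1 + q 2 * q 0, q 1 * q 2 + q 0 * q 1,
          q 2 * q 0 + q 1 * q 2] k /
        (2 * (q 0 * q 1 + q 1 * q 2 + q 2 * q 0)))
      (fun k => ![p 0 ^ 2, p 1 ^ 2, p 2 ^ 2] k / (p 0 ^ 2 + p 1 ^ 2 + p 2 ^ 2)) := by

  have E01 : E 0 ≤ E 1 := hE (by decide)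
  have E12 : E 1 ≤ E 2 := hE (by decide)
  have E02 : E 0 ≤ E 2 := hE (by decide)
  have p0 : 0 < p 0 := hp ▸ gibbs_pos E β 0
  have p1 : 0 < p 1 := hp ▸ gibbs_pos E β 1
  have p2 : 0 < p 2 := hp ▸ gibbs_pos E β 2
  have q0 : 0 < q 0 := hq ▸ gibbs_pos E β' 0
  have q1 : 0 < q 1 := hq ▸ gibbs_pos E β' 1
  have q2 : 0 < q 2 := hq ▸ gibbs_pos E β' 2
  have q01 : q 1 ≤ q 0 := hq ▸ gibbs_anti_s16 E β' hβ' 0 1 E01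
  have q12 : q 2 ≤ q 1 := hq ▸ gibbs_anti_s16 E β' hβ' 1 2 E12
  have r01 : p 1 * q 0 ≤ p 0 * q 1 := by
    rw [hp, hq]; exact gibbs_ratio E β' β hββ 0 1 E01
  have r02 : p 2 * q 0 ≤ p 0 * q 2 := by
    rw [hp, hq]; exact gibbs_ratio E β' β hββ 0 2 E02
  have r12 : p 2 * q 1 ≤ p 1 * q 2 := by
    rw [hp, hq]; exact gibbs_ratio E β' β hββ 1 2 E12
  clear hp hq
  have s01 := sq_ratio _ _ _ _ p1 q0 r01
  have s02 := sq_ratio _ _ _ _ p2 q0 r02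
  have s12 := sq_ratio _ _ _ _ p2 q1 r12
  have hD : 0 < 2 * (q 0 * q 1 + q 1 * q 2 + q 2 * q 0) := by positivity
  have hP : 0 < p 0 ^ 2 + p 1 ^ 2 + p 2 ^ 2 := by positivity
  have hQ : 0 < q 0 ^ 2 + q 1 ^ 2 + q 2 ^ 2 := by positivity
  apply majorized_three
  · apply div_le_div_of_nonneg_right _ hD.le
    simp only [Matrix.cons_val]
    nlinarith
  · apply div_le_div_of_nonneg_right _ hD.le
    simp only [Matrix.cons_val]
    nlinarith
  · simp only [Matrix.cons_val]
    refine (ineq_top _ _ _ q2 q01 q12).trans ?_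
    rw [div_le_div_iff₀ hQ hP]
    linarith
  · simp only [Matrix.cons_val]
    refine le_trans ?_ (ineq_bot _ _ _ q2 q01 q12)
    rw [div_le_div_iff₀ hP hQ]
    linarith
  · simp only [Fin.sum_univ_three, Matrix.cons_val]
    rw [← add_div, ← add_div, ← add_div, ← add_div, div_self hP.ne', div_eq_one_iff_eq hD.ne']
    ring
end

section
/- Let d ≥ 2 and let p ∈ ℝ^d be a probability vector with p_0 ≥ p_1 ≥ … ≥ p_{d−1} ≥ 0 and ∑_{i} p_i = 1, and assume ∑_{i} p_i(1−p_i) > 0. Then the vector with entries p_i²/∑_{j} p_j² majorizes the vector with entries p_i(1−p_i)/∑_{j} p_j(1−p_j). -/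
theorem squared_majorizes_complement
    (d : ℕ) (hd : 2 ≤ d) (p : Fin d → ℝ)
    (hmono : Antitone p) (hnn : ∀ i, 0 ≤ p i) (hsum : ∑ i, p i = 1)
    (hpos : 0 < ∑ i, p i * (1 - p i)) :
    IsMajorizedBy
      (fun i => p i * (1 - p i) / ∑ j, p j * (1 - p j))
      (fun i => p i ^ 2 / ∑ j, p j ^ 2) := by
  have hQP : ∑ i, p i * (1 - p i) = 1 - ∑ i, p i ^ 2 := by
    rw [← hsum, ← Finset.sum_sub_distrib]
    refine Finset.sum_congr rfl fun i _ => ?_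
    rw [hsum]; ring
  have hP : 0 < ∑ i, p i ^ 2 := by
    have h0 : 0 ≤ ∑ i, p i ^ 2 := Finset.sum_nonneg fun i _ => sq_nonneg _
    rcases h0.lt_or_eq with h | h
    · exact h
    · exfalso
      have h2 := (Finset.sum_eq_zero_iff_of_nonneg (fun i _ => sq_nonneg (p i))).1 h.symm
      have h3 : ∑ i, p i = 0 := Finset.sum_eq_zero fun i hi => by simpa using h2 i hi
      linarith
  have hq : Antitone (fun i => p i * (1 - p i)) := by
    intro i j hij
    rcases eq_or_ne i j with h | h
    · rw [h]
    · have h1 : p i + p j ≤ 1 := by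
        rw [← hsum, ← Finset.sum_pair h]
        exact Finset.sum_le_sum_of_subset_of_nonneg (Finset.subset_univ _) fun x _ _ => hnn x
      have h2 := hmono hij
      show p j * (1 - p j) ≤ p i * (1 - p i)
      nlinarith [mul_nonneg (sub_nonneg.2 h2) (sub_nonneg.2 h1)]
  refine ⟨fun k hk => ?_, ?_⟩
  · obtain ⟨T, j, hT, hTj, hTj'⟩ : ∃ (T : Finset (Fin d)) (j : Fin d), T.card = k ∧
        (∀ i ∈ T, i ≤ j) ∧ (∀ i ∉ T, j ≤ i) := by
      refine ⟨Finset.univ.filter fun i => i.val < k, ⟨k - 1, by omega⟩, ?_, ?_, ?_⟩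
      · rw [Fin.card_filter_val_lt]; omega
      · intro i hi
        simp only [Finset.mem_filter, Finset.mem_univ, true_and] at hi
        rw [Fin.le_def]; simp only; omega
      · intro i hi
        simp only [Finset.mem_filter, Finset.mem_univ, true_and] at hi
        rw [Fin.le_def]; simp only; omega
    unfold kMaxSum
    apply csSup_le
    · exact ⟨_, T, hT, rfl⟩
    · rintro _ ⟨S, hS, rfl⟩
      simp only [Set.mem_setOf_eq] at hS
      refine le_trans ?_ (le_csSup (Set.toFinite _).bddAbove ⟨T, hT, rfl⟩)
      simp only
      rw [← Finset.sum_div, ← Finset.sum_div, div_le_div_iff₀ hpos hP]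
      have hST : ∑ i ∈ S, p i * (1 - p i) ≤ ∑ i ∈ T, p i * (1 - p i) := by
        have hc : (S \ T).card = (T \ S).card := Finset.card_sdiff_comm (hS.trans hT.symm)
        rw [← Finset.sum_inter_add_sum_sdiff S T, ← Finset.sum_inter_add_sum_sdiff T S,
          Finset.inter_comm T S]
        have h1 := Finset.sum_le_card_nsmul (S \ T) (fun i => p i * (1 - p i)) (p j * (1 - p j))
          fun i hi => hq (hTj' i (Finset.mem_sdiff.1 hi).2)
        have h2 := Finset.card_nsmul_le_sum (T \ S) (fun i => p i * (1 - p i)) (p j * (1 - p j))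
          fun i hi => hq (hTj i (Finset.mem_sdiff.1 hi).1)
        rw [hc] at h1
        linarith
      have hq2 : ∑ i ∈ T, p i * (1 - p i) = ∑ i ∈ T, p i - ∑ i ∈ T, p i ^ 2 := by
        rw [← Finset.sum_sub_distrib]
        exact Finset.sum_congr rfl fun i _ => by ring
      have hA := Finset.sum_add_sum_compl T p
      have hB := Finset.sum_add_sum_compl T fun i => p i ^ 2
      have hB1 : p j * ∑ i ∈ T, p i ≤ ∑ i ∈ T, p i ^ 2 := by
        rw [Finset.mul_sum]
        refine Finset.sum_le_sum fun i hi => ?_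
        rw [sq]
        exact mul_le_mul_of_nonneg_right (hmono (hTj i hi)) (hnn i)
      have hB2 : ∑ i ∈ Tᶜ, p i ^ 2 ≤ p j * ∑ i ∈ Tᶜ, p i := by
        rw [Finset.mul_sum]
        refine Finset.sum_le_sum fun i hi => ?_
        rw [sq]
        exact mul_le_mul_of_nonneg_right (hmono (hTj' i (Finset.mem_compl.1 hi))) (hnn i)
      have hA0 : 0 ≤ ∑ i ∈ T, p i := Finset.sum_nonneg fun i _ => hnn i
      have hA1 : 0 ≤ ∑ i ∈ Tᶜ, p i := Finset.sum_nonneg fun i _ => hnn i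
      refine (mul_le_mul_of_nonneg_right hST hP.le).trans ?_
      rw [hq2, hQP]
      rw [hsum] at hA
      rw [← hB]
      have e1 := mul_le_mul_of_nonneg_left hB1 hA1
      have e2 := mul_le_mul_of_nonneg_left hB2 hA0
      have e3 : ∑ i ∈ Tᶜ, p i = 1 - ∑ i ∈ T, p i := by linarith
      rw [e3] at e1 e2
      nlinarith
  · simp only
    rw [← Finset.sum_div, ← Finset.sum_div, div_self hpos.ne', div_self hP.ne']
end
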